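/- Let K and L be convex bodies in ℝ⁴ having countably many diameters. Assume that there exists a diameter d_K(ζ) of K (ζ ∈ S³) such that for every w ∈ S³ with w·ζ = 0, the projections K|w^⊥ and L|w^⊥ are directly congruent, and that these projections have no (ζ, π)-symmetries and no (u, π)-symmetries for any u ∈ ζ^⊥ ∩ w^⊥ ∩ S³. Then K = L + b or K = 𝒪L + b for some b ∈ ℝ⁴, where 𝒪 ∈ O(4) is the orthogonal transformation with 𝒪(ζ) = ζ and 𝒪 = −I on ζ^⊥. If, in addition, the projections K|ζ^⊥ and L|ζ^⊥ are directly congruent and have no rigid motion symmetries, then K = L + b for some b ∈ ℝ⁴. -/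

import Mathlib

noncomputable section

open scoped RealInnerProductSpace

/-- `ℝ⁴` as a Euclidean space. -/
abbrev E4 := EuclideanSpace ℝ (Fin 4)

/-- The unit sphere `S³` in `ℝ⁴`. -/
def sph : Set E4 := Metric.sphere (0 : E4) 1

/-- The great subsphere `S²(w) = {θ ∈ S³ : θ·w = 0}`. -/
def S2 (w : E4) : Set E4 := {θ ∈ sph | ⟪θ, w⟫ = 0}

/-- The orthogonal transformation `𝒪` determined by `ζ`: for a unit vector `ζ` the map
`x ↦ 2⟪x,ζ⟫ζ - x` satisfies `𝒪 ζ = ζ` and `𝒪 = -I` on `ζ^⊥`. -/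
def Ocal (ζ x : E4) : E4 := (2 * ⟪x, ζ⟫) • ζ - x

/-- `φ` is (the extension to `ℝ⁴` of) an element of `SO(3, S²(w))`:
a linear isometry of `ℝ⁴` fixing `w`, of determinant `1`, i.e. a rotation
of the `3`-dimensional subspace `w^⊥`. -/
def IsRot (w : E4) (φ : E4 ≃ₗᵢ[ℝ] E4) : Prop :=
  φ w = w ∧ LinearMap.det (φ.toLinearEquiv : E4 →ₗ[ℝ] E4) = 1

/-- `φ ∈ SO(3, S²(w))` is a rotation by the angle `α·π` around the axis `u ∈ S²(w)`:
it fixes `w` and `u`, and turns the plane orthogonal to `w` and `u` by the angle `α·π`. -/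
def IsRotAngleAbout (w u : E4) (α : ℝ) (φ : E4 ≃ₗᵢ[ℝ] E4) : Prop :=
  IsRot w φ ∧ φ u = u ∧
    ∀ v : E4, ⟪v, w⟫ = 0 → ⟪v, u⟫ = 0 →
      ⟪φ v, v⟫ = Real.cos (α * Real.pi) * ⟪v, v⟫

/-- The support function of `K`. -/
def suppFn (K : Set E4) (x : E4) : ℝ := sSup ((fun y => ⟪x, y⟫) '' K)

/-- The width function of `K`. -/
def widthFn (K : Set E4) (x : E4) : ℝ := suppFn K x + suppFn K (-x)

/-- The maximal width of `K`. -/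
def maxWidth (K : Set E4) : ℝ := sSup (widthFn K '' sph)

/-- Directions of diameters of a convex body `K`: the set of `θ ∈ S³` at which the
width function attains its maximum. -/
def DiamDirs (K : Set E4) : Set E4 := {θ ∈ sph | widthFn K θ = maxWidth K}

/-- Orthogonal projection onto the hyperplane `w^⊥` (for a unit vector `w`). -/
def projHyp (w x : E4) : E4 := x - ⟪x, w⟫ • w

/-- A convex body: a compact convex set with nonempty interior. -/
def IsConvexBody (K : Set E4) : Prop := IsCompact K ∧ Convex ℝ K ∧ (interior K).Nonempty

/-- Subsets `D₁`, `D₂` of `w^⊥` are directly congruent: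
`φ(D₁) = D₂ + a` for some rotation `φ ∈ SO(3, w^⊥)` and some `a ∈ w^⊥`. -/
def DirCong (w : E4) (D₁ D₂ : Set E4) : Prop :=
  ∃ φ : E4 ≃ₗᵢ[ℝ] E4, IsRot w φ ∧
    ∃ a : E4, ⟪a, w⟫ = 0 ∧ φ '' D₁ = (fun x => x + a) '' D₂

/-- The subset `D` of the `3`-dimensional subspace `w^⊥` has a `(u, π)`-symmetry:
`φ(D) = D + a` for the rotation `φ` by the angle `π` about `u` and some `a ∈ w^⊥`. -/
def HasPiSymSet (w u : E4) (D : Set E4) : Prop :=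
  ∃ φ : E4 ≃ₗᵢ[ℝ] E4, IsRotAngleAbout w u 1 φ ∧
    ∃ a : E4, ⟪a, w⟫ = 0 ∧ φ '' D = (fun x => x + a) '' D

/-- The subset `D` of `ζ^⊥` has a rigid motion symmetry: `φ(D) = D + a` for some
non-identical orthogonal transformation `φ ∈ O(3, ζ^⊥)` and some `a ∈ ζ^⊥`. -/
def HasRigidSym (ζ : E4) (D : Set E4) : Prop :=
  ∃ φ : E4 ≃ₗᵢ[ℝ] E4, φ ζ = ζ ∧ (∃ x : E4, ⟪x, ζ⟫ = 0 ∧ φ x ≠ x) ∧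
    ∃ a : E4, ⟪a, ζ⟫ = 0 ∧ φ '' D = (fun x => x + a) '' D

section DirectCongruence

open scoped Matrix
open MeasureTheory Filter Topology

lemma integral_sin_pow_mul_succ (k : ℕ) :
    (∫ θ in (0:ℝ)..Real.pi, Real.sin θ ^ (k + 1)) * (∫ θ in (0:ℝ)..Real.pi, Real.sin θ ^ k)
      = 2 * Real.pi / (k + 1) := by
  induction k with
  | zero => simp [integral_sin]; ring
  | succ k ih =>
    have h := integral_sin_pow (a := 0) (b := Real.pi) k
    simp only [Real.sin_zero, Real.sin_pi, ne_eq, Nat.add_eq_zero_iff, one_ne_zero, and_false,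
      not_false_eq_true, zero_pow, zero_mul, sub_self, zero_div, zero_add] at h
    rw [show k + 1 + 1 = k + 2 from rfl, h]
    rw [mul_assoc, mul_comm (∫ θ in (0:ℝ)..Real.pi, Real.sin θ ^ k), ih]
    push_cast
    field_simp
    ring

lemma continuous_integral_sin_sin {A : ℝ → ℝ} (hA : Continuous A) :
    Continuous fun α : ℝ => ∫ θ in (0:ℝ)..Real.pi, A (Real.sin α * Real.sin θ) := by
  apply intervalIntegral.continuous_parametric_intervalIntegral_of_continuous'
  fun_prop

lemma continuous_integral_sin_sin_mul {A : ℝ → ℝ} (hA : Continuous A) :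
    Continuous fun α : ℝ =>
      (∫ θ in (0:ℝ)..Real.pi, A (Real.sin α * Real.sin θ)) * Real.sin α :=
  (continuous_integral_sin_sin hA).mul Real.continuous_sin

lemma octant_integral_polynomial (p : Polynomial ℝ) :
    ∫ α in (0:ℝ)..Real.pi,
        (∫ θ in (0:ℝ)..Real.pi, p.eval (Real.sin α * Real.sin θ)) * Real.sin α
      = 2 * Real.pi * ∫ z in (0:ℝ)..1, p.eval z := by
  induction p using Polynomial.induction_on' with
  | add p q hp hq =>
    have hpc : Continuous fun x => p.eval x := p.continuous
    have hqc : Continuous fun x => q.eval x := q.continuous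
    simp only [Polynomial.eval_add]
    rw [intervalIntegral.integral_add (hpc.intervalIntegrable _ _) (hqc.intervalIntegrable _ _),
      mul_add, ← hp, ← hq, ← intervalIntegral.integral_add]
    · congr 1
      ext α
      rw [intervalIntegral.integral_add, add_mul]
      · exact Continuous.intervalIntegrable (by fun_prop) _ _
      · exact Continuous.intervalIntegrable (by fun_prop) _ _
    · exact (continuous_integral_sin_sin_mul hpc).intervalIntegrable _ _
    · exact (continuous_integral_sin_sin_mul hqc).intervalIntegrable _ _
  | monomial k a =>
    simp only [Polynomial.eval_monomial, mul_pow]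
    simp only [intervalIntegral.integral_const_mul]
    have : ∀ α : ℝ, a * (Real.sin α ^ k * ∫ θ in (0:ℝ)..Real.pi, Real.sin θ ^ k) * Real.sin α
        = (a * ∫ θ in (0:ℝ)..Real.pi, Real.sin θ ^ k) * Real.sin α ^ (k + 1) := by
      intro α; ring
    simp only [this, intervalIntegral.integral_const_mul]
    have h := integral_sin_pow_mul_succ k
    rw [mul_assoc, mul_comm (∫ θ in (0:ℝ)..Real.pi, Real.sin θ ^ k), h]
    simp
    ring

lemma octant_integral {A : ℝ → ℝ} (hA : Continuous A) :
    ∫ α in (0:ℝ)..Real.pi,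
        (∫ θ in (0:ℝ)..Real.pi, A (Real.sin α * Real.sin θ)) * Real.sin α
      = 2 * Real.pi * ∫ z in (0:ℝ)..1, A z := by
  have hpi := Real.pi_pos
  set C : ℝ := Real.pi * Real.pi + 2 * Real.pi
  have hC : 0 < C := by positivity
  refine eq_of_forall_dist_le fun ε hε => ?_
  rw [Real.dist_eq]
  obtain ⟨p, hp⟩ := exists_polynomial_near_of_continuousOn 0 1 A hA.continuousOn (ε / C)
    (by positivity)
  have hpc : Continuous fun x => p.eval x := p.continuous
  have hmem : ∀ α ∈ Set.uIoc 0 Real.pi, ∀ θ ∈ Set.uIoc 0 Real.pi,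
      Real.sin α * Real.sin θ ∈ Set.Icc (0:ℝ) 1 := by
    intro α hα θ hθ
    rw [Set.uIoc_of_le hpi.le] at hα hθ
    have h1 := Real.sin_nonneg_of_nonneg_of_le_pi hα.1.le hα.2
    have h2 := Real.sin_nonneg_of_nonneg_of_le_pi hθ.1.le hθ.2
    exact ⟨mul_nonneg h1 h2, mul_le_one₀ (Real.sin_le_one _) h2 (Real.sin_le_one _)⟩
  have e1 : |(∫ z in (0:ℝ)..1, A z) - ∫ z in (0:ℝ)..1, p.eval z| ≤ ε / C := by
    rw [← intervalIntegral.integral_sub (hA.intervalIntegrable _ _) (hpc.intervalIntegrable _ _)]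
    have := intervalIntegral.norm_integral_le_of_norm_le_const (a := 0) (b := 1)
      (f := fun z => A z - p.eval z) (C := ε / C) (by
        intro z hz
        rw [Set.uIoc_of_le zero_le_one] at hz
        rw [Real.norm_eq_abs, abs_sub_comm]
        exact (hp z ⟨hz.1.le, hz.2⟩).le)
    simpa using this
  have e2 : |(∫ α in (0:ℝ)..Real.pi,
        (∫ θ in (0:ℝ)..Real.pi, A (Real.sin α * Real.sin θ)) * Real.sin α)
        - ∫ α in (0:ℝ)..Real.pi,
        (∫ θ in (0:ℝ)..Real.pi, p.eval (Real.sin α * Real.sin θ)) * Real.sin α|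
        ≤ (ε / C * Real.pi) * Real.pi := by
    rw [← intervalIntegral.integral_sub
      ((continuous_integral_sin_sin_mul hA).intervalIntegrable _ _)
      ((continuous_integral_sin_sin_mul hpc).intervalIntegrable _ _)]
    have := intervalIntegral.norm_integral_le_of_norm_le_const (a := 0) (b := Real.pi)
      (f := fun α => (∫ θ in (0:ℝ)..Real.pi, A (Real.sin α * Real.sin θ)) * Real.sin α
        - (∫ θ in (0:ℝ)..Real.pi, p.eval (Real.sin α * Real.sin θ)) * Real.sin α)
      (C := ε / C * Real.pi) (by
        intro α hα
        have h3 := intervalIntegral.norm_integral_le_of_norm_le_const (a := 0) (b := Real.pi)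
          (f := fun θ => A (Real.sin α * Real.sin θ) - p.eval (Real.sin α * Real.sin θ))
          (C := ε / C) (by
            intro θ hθ
            rw [Real.norm_eq_abs, abs_sub_comm]
            exact (hp _ (hmem α hα θ hθ)).le)
        rw [intervalIntegral.integral_sub (Continuous.intervalIntegrable (by fun_prop) _ _)
          (Continuous.intervalIntegrable (by fun_prop) _ _)] at h3
        rw [← sub_mul, norm_mul]
        simp only [sub_zero, abs_of_pos hpi] at h3
        calc _ ≤ (ε / C * Real.pi) * 1 := by
              apply mul_le_mul h3 (Real.abs_sin_le_one _) (abs_nonneg _) (by positivity)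
          _ = _ := mul_one _)
    simpa [abs_of_pos hpi] using this
  rw [octant_integral_polynomial p] at e2
  have e3 : ε = (ε / C * Real.pi) * Real.pi + 2 * Real.pi * (ε / C) := by
    have : ε = ε / C * C := by field_simp
    nth_rewrite 1 [this]
    simp only [C]; ring
  rw [abs_le] at *
  constructor <;> nlinarith [e1.1, e1.2, e2.1, e2.2]

lemma eq_zero_of_integral_sin_eq_zero {A : ℝ → ℝ} (hA : Continuous A)
    (h : ∀ s ∈ Set.Icc (0:ℝ) 1, ∫ θ in (0:ℝ)..Real.pi, A (s * Real.sin θ) = 0) : A 1 = 0 := by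
  have hpi := Real.pi_pos
  have h1 : ∀ r ∈ Set.Icc (0:ℝ) 1, ∫ z in (0:ℝ)..r, A z = 0 := by
    intro r hr
    have h2 := octant_integral (A := fun z => A (r * z)) (by fun_prop)
    have h3 : ∫ α in (0:ℝ)..Real.pi,
        (∫ θ in (0:ℝ)..Real.pi, A (r * (Real.sin α * Real.sin θ))) * Real.sin α = 0 := by
      refine (intervalIntegral.integral_congr (g := fun _ => 0) ?_).trans (by simp)
      intro α hα
      rw [Set.uIcc_of_le hpi.le] at hα
      have h1 := Real.sin_nonneg_of_nonneg_of_le_pi hα.1 hα.2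
      have := h (r * Real.sin α) ⟨mul_nonneg hr.1 h1, mul_le_one₀ hr.2 h1 (Real.sin_le_one _)⟩
      simp only [mul_assoc] at this
      simp only [this, zero_mul]
    rw [h3] at h2
    have h4 : ∫ z in (0:ℝ)..1, A (r * z) = 0 := by
      have : 2 * Real.pi ≠ 0 := by positivity
      simpa [this] using h2.symm
    have := intervalIntegral.smul_integral_comp_mul_left (a := 0) (b := 1) A r
    rw [h4] at this
    simpa using this.symm
  have h5 : ∀ r ∈ Set.Ioo (0:ℝ) 1, A r = 0 := by
    intro r hr
    have hd : HasDerivAt (fun u => ∫ z in (0:ℝ)..u, A z) (A r) r :=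
      intervalIntegral.integral_hasDerivAt_right (hA.intervalIntegrable _ _)
        (hA.stronglyMeasurableAtFilter _ _) hA.continuousAt
    have hd0 : HasDerivAt (fun u => ∫ z in (0:ℝ)..u, A z) 0 r := by
      apply (hasDerivAt_const r (0:ℝ)).congr_of_eventuallyEq
      filter_upwards [Icc_mem_nhds hr.1 hr.2] with u hu
      exact h1 u hu
    exact hd.unique hd0
  have hcl : (1:ℝ) ∈ closure (Set.Ioo (0:ℝ) 1) := by
    rw [closure_Ioo (by norm_num)]; simp
  have : IsClosed {r | A r = 0} := isClosed_eq hA continuous_const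
  exact this.closure_subset_iff.2 h5 hcl

lemma exists_cos_sin_eq {p q : ℝ} (h : p ^ 2 + q ^ 2 = 1) :
    ∃ θ ∈ Set.Icc 0 (2 * Real.pi), p = Real.cos θ ∧ q = Real.sin θ := by
  have hpi := Real.pi_pos
  have h1 : -1 ≤ p := by nlinarith
  have h2 : p ≤ 1 := by nlinarith
  have hs : Real.sin (Real.arccos p) = |q| := by
    rw [Real.sin_arccos, show 1 - p ^ 2 = q ^ 2 by linarith, Real.sqrt_sq_eq_abs]
  have h3 := Real.arccos_nonneg p
  have h4 := Real.arccos_le_pi p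
  rcases le_total 0 q with hq | hq
  · refine ⟨Real.arccos p, ⟨h3, by linarith⟩, (Real.cos_arccos h1 h2).symm, ?_⟩
    rw [hs, abs_of_nonneg hq]
  · refine ⟨2 * Real.pi - Real.arccos p, ⟨by linarith, by linarith⟩, ?_, ?_⟩
    · rw [Real.cos_two_pi_sub, Real.cos_arccos h1 h2]
    · rw [Real.sin_two_pi_sub, hs, abs_of_nonpos hq, neg_neg]

lemma integral_periodic_comp {k : ℝ → ℝ} (hk : Function.Periodic k (2 * Real.pi)) {ε : ℝ}
    (hε : ε = 1 ∨ ε = -1) (α : ℝ) :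
    ∫ θ in (0:ℝ)..2 * Real.pi, k (ε * θ + α) = ∫ θ in (0:ℝ)..2 * Real.pi, k θ := by
  rcases hε with rfl | rfl
  · have := intervalIntegral.integral_comp_add_right (a := 0) (b := 2 * Real.pi) k α
    simp only [one_mul]
    rw [this, zero_add, add_comm, hk.intervalIntegral_add_eq α 0, zero_add]
  · have := intervalIntegral.integral_comp_sub_left (a := 0) (b := 2 * Real.pi) k α
    have e : ∀ θ : ℝ, (-1 : ℝ) * θ + α = α - θ := fun θ => by ring
    simp only [e]
    have h2 := hk.intervalIntegral_add_eq (α - 2 * Real.pi) 0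
    rw [sub_add_cancel, zero_add] at h2
    rw [this, sub_zero, h2]

/-- The point at angle `θ` on the circle spanned by the frame `a`, `b`. -/
def cpt (a b : Fin 3 → ℝ) (θ : ℝ) : Fin 3 → ℝ := Real.cos θ • a + Real.sin θ • b

lemma continuous_cpt {X : Type*} [TopologicalSpace X] {a b : X → Fin 3 → ℝ} {θ : X → ℝ}
    (ha : Continuous a) (hb : Continuous b) (hθ : Continuous θ) :
    Continuous fun x => cpt (a x) (b x) (θ x) := by
  unfold cpt
  fun_prop

lemma cpt_add_pi (a b : Fin 3 → ℝ) (θ : ℝ) : cpt a b (θ + Real.pi) = -cpt a b θ := by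
  simp [cpt]
  abel

lemma cpt_periodic (a b : Fin 3 → ℝ) : Function.Periodic (cpt a b) (2 * Real.pi) := by
  intro θ
  simp [cpt]

lemma cpt_add (a b : Fin 3 → ℝ) (θ ψ : ℝ) :
    cpt a b (θ + ψ) = cpt (cpt a b θ) (cpt a b (θ + Real.pi / 2)) ψ := by
  simp only [cpt, Real.cos_add, Real.sin_add, Real.cos_pi_div_two, Real.sin_pi_div_two]
  module

lemma integral_half_circle {f : (Fin 3 → ℝ) → ℝ} (hf : Continuous f) (he : ∀ x, f (-x) = f x)
    {a b : Fin 3 → ℝ} (h : ∫ θ in (0:ℝ)..2 * Real.pi, f (cpt a b θ) = 0) :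
    ∫ θ in (0:ℝ)..Real.pi, f (cpt a b θ) = 0 := by
  have hc : Continuous fun θ => f (cpt a b θ) :=
    hf.comp (continuous_cpt continuous_const continuous_const continuous_id)
  have h1 : ∫ θ in Real.pi..2 * Real.pi, f (cpt a b θ) = ∫ θ in (0:ℝ)..Real.pi, f (cpt a b θ) := by
    have := intervalIntegral.integral_comp_add_right (a := 0) (b := Real.pi)
      (fun θ => f (cpt a b θ)) Real.pi
    simp only [cpt_add_pi, he] at this
    rw [this, zero_add, two_mul]
  rw [← intervalIntegral.integral_add_adjacent_intervals (b := Real.pi)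
    (hc.intervalIntegrable _ _) (hc.intervalIntegrable _ _), h1] at h
  linarith

lemma exists_orthonormal_frame {x : Fin 3 → ℝ} (hx : x ⬝ᵥ x = 1) :
    ∃ a b : Fin 3 → ℝ, a ⬝ᵥ a = 1 ∧ b ⬝ᵥ b = 1 ∧ a ⬝ᵥ b = 0 ∧ a ⬝ᵥ x = 0 ∧ b ⬝ᵥ x = 0 := by
  have key : ∃ v : Fin 3 → ℝ, v ⬝ᵥ x = 0 ∧ 0 < v ⬝ᵥ v := by
    by_cases h : x 0 = 0
    · refine ⟨![1, 0, 0], ?_, ?_⟩ <;> simp [dotProduct, Fin.sum_univ_three, h]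
    · refine ⟨![-x 1, x 0, 0], ?_, ?_⟩
      · simp [dotProduct, Fin.sum_univ_three]; ring
      · simp only [dotProduct, Fin.sum_univ_three]
        have := mul_self_pos.2 h
        simp
        nlinarith [mul_self_nonneg (x 1)]
  obtain ⟨v, hv, hvv⟩ := key
  set a := (1 / Real.sqrt (v ⬝ᵥ v)) • v with ha
  have haa : a ⬝ᵥ a = 1 := by
    have := Real.mul_self_sqrt hvv.le
    have h2 := (Real.sqrt_pos.2 hvv).ne'
    simp only [ha, smul_dotProduct, dotProduct_smul, smul_eq_mul]
    field_simp
    rw [sq, this]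
  have hax : a ⬝ᵥ x = 0 := by simp [ha, smul_dotProduct, hv]
  refine ⟨a, crossProduct x a, haa, ?_, ?_, hax, ?_⟩
  · rw [cross_dot_cross, hx, haa, hax, dotProduct_comm x a, hax]; ring
  · exact dot_cross_self _ _
  · rw [dotProduct_comm]; exact dot_self_cross _ _

/-- Injectivity of the Funk transform on even continuous functions. -/
lemma eq_zero_of_integral_great_circle {f : (Fin 3 → ℝ) → ℝ} (hf : Continuous f)
    (he : ∀ x, f (-x) = f x)
    (h : ∀ a b : Fin 3 → ℝ, a ⬝ᵥ a = 1 → b ⬝ᵥ b = 1 → a ⬝ᵥ b = 0 →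
      ∫ θ in (0:ℝ)..2 * Real.pi, f (cpt a b θ) = 0)
    {x : Fin 3 → ℝ} (hx : x ⬝ᵥ x = 1) : f x = 0 := by
  obtain ⟨e₁, e₂, h11, h22, h12, h1x, h2x⟩ := exists_orthonormal_frame hx
  set A : ℝ → ℝ := fun z => ∫ φ in (0:ℝ)..2 * Real.pi,
    f (Real.sqrt (1 - z ^ 2) • cpt e₁ e₂ φ + z • x) with hAdef
  have hA : Continuous A := by
    apply intervalIntegral.continuous_parametric_intervalIntegral_of_continuous'
    refine hf.comp ?_
    have : Continuous fun p : ℝ × ℝ => cpt e₁ e₂ p.2 :=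
      continuous_cpt continuous_const continuous_const continuous_snd
    fun_prop
  have key : A 1 = 0 := by
    refine eq_zero_of_integral_sin_eq_zero hA fun s hs => ?_
    set c := Real.sqrt (1 - s ^ 2) with hc
    have hcs : c ^ 2 = 1 - s ^ 2 := Real.sq_sqrt (by nlinarith [hs.1, hs.2])
    set a : ℝ → Fin 3 → ℝ := fun φ => c • cpt e₁ e₂ φ + s • x with ha
    set b : ℝ → Fin 3 → ℝ := fun φ => cpt e₁ e₂ (φ + Real.pi / 2) with hb
    have hac : Continuous a := by
      have : Continuous fun φ => cpt e₁ e₂ φ :=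
        continuous_cpt continuous_const continuous_const continuous_id
      fun_prop
    have hbc : Continuous b :=
      continuous_cpt continuous_const continuous_const (by fun_prop)
    have h21 : e₂ ⬝ᵥ e₁ = 0 := by rw [dotProduct_comm, h12]
    have hx1 : x ⬝ᵥ e₁ = 0 := by rw [dotProduct_comm, h1x]
    have hx2 : x ⬝ᵥ e₂ = 0 := by rw [dotProduct_comm, h2x]
    have hz : ∀ φ, ∫ θ in (0:ℝ)..Real.pi, f (cpt (b φ) (a φ) θ) = 0 := by
      intro φ
      apply integral_half_circle hf he
      have hsc := Real.sin_sq_add_cos_sq φ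
      apply h
      · simp only [hb, cpt, add_dotProduct, dotProduct_add, smul_dotProduct, dotProduct_smul,
          h11, h22, h12, h21, smul_eq_mul, Real.cos_add_pi_div_two, Real.sin_add_pi_div_two]
        linear_combination hsc
      · simp only [ha, cpt, add_dotProduct, dotProduct_add, smul_dotProduct, dotProduct_smul,
          h11, h22, h12, h21, hx1, hx2, h1x, h2x, hx, smul_eq_mul]
        linear_combination c ^ 2 * hsc + hcs
      · simp only [ha, hb, cpt, add_dotProduct, dotProduct_add, smul_dotProduct, dotProduct_smul,
          h11, h22, h12, h21, h1x, h2x, smul_eq_mul, Real.cos_add_pi_div_two,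
          Real.sin_add_pi_div_two]
        ring
    have hinner : ∀ θ, ∫ φ in (0:ℝ)..2 * Real.pi, f (cpt (b φ) (a φ) θ)
        = A (s * Real.sin θ) := by
      intro θ
      have hz1 : (s * Real.sin θ) ^ 2 ≤ 1 := by
        rw [mul_pow]
        exact mul_le_one₀ (by nlinarith [hs.1, hs.2]) (sq_nonneg _) (Real.sin_sq_le_one θ)
      set ρ := Real.sqrt (1 - (s * Real.sin θ) ^ 2) with hρ
      have hρ2 : ρ ^ 2 = 1 - (s * Real.sin θ) ^ 2 := Real.sq_sqrt (by linarith)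
      obtain ⟨ψ, hψ1, hψ2⟩ : ∃ ψ, c * Real.sin θ = ρ * Real.cos ψ ∧
          Real.cos θ = ρ * Real.sin ψ := by
        have hsc := Real.sin_sq_add_cos_sq θ
        by_cases h0 : ρ = 0
        · have h1 : (c * Real.sin θ) ^ 2 + Real.cos θ ^ 2 = 0 := by
            rw [h0] at hρ2
            linear_combination (Real.sin θ) ^ 2 * hcs + hsc - hρ2
          refine ⟨0, ?_, ?_⟩
          · rw [h0, zero_mul]; nlinarith [sq_nonneg (c * Real.sin θ), sq_nonneg (Real.cos θ)]
          · rw [h0, zero_mul]; nlinarith [sq_nonneg (c * Real.sin θ), sq_nonneg (Real.cos θ)]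
        · obtain ⟨ψ, -, h1, h2⟩ := exists_cos_sin_eq (p := c * Real.sin θ / ρ)
            (q := Real.cos θ / ρ) (by
              field_simp
              linear_combination (Real.sin θ) ^ 2 * hcs + hsc - hρ2)
          refine ⟨ψ, ?_, ?_⟩
          · rw [← h1]; field_simp
          · rw [← h2]; field_simp
      have hk : Function.Periodic (fun φ => f (ρ • cpt e₁ e₂ φ + (s * Real.sin θ) • x))
          (2 * Real.pi) := by
        intro φ; simp only [cpt_periodic e₁ e₂ φ]
      rw [hAdef]
      simp only
      rw [← integral_periodic_comp hk (Or.inl rfl) ψ]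
      congr 1
      ext φ
      congr 1
      rw [one_mul, cpt_add]
      simp only [ha, hb]
      generalize cpt e₁ e₂ φ = u
      generalize cpt e₁ e₂ (φ + Real.pi / 2) = v
      simp only [cpt]
      rw [smul_add ρ, smul_smul ρ, smul_smul ρ, ← hψ1, ← hψ2]
      module
    simp only [← hinner]
    rw [intervalIntegral_intervalIntegral_swap]
    · simp [hz]
    · have hcont : Continuous (Function.uncurry fun θ φ => f (cpt (b φ) (a φ) θ)) :=
        hf.comp (continuous_cpt (hbc.comp continuous_snd) (hac.comp continuous_snd)
          continuous_fst)
      exact (hcont.continuousOn.integrableOn_compact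
        (isCompact_uIcc.prod isCompact_uIcc)).mono_set
          (Set.prod_mono Set.uIoc_subset_uIcc Set.uIoc_subset_uIcc)
  have h2 : A 1 = 2 * Real.pi * f x := by
    simp [hAdef]
  rw [h2] at key
  have : 2 * Real.pi ≠ 0 := by positivity
  simpa [this] using key

/-- `a`, `b` is an orthonormal pair of vectors of `ℝ³`. -/
def IsFrame (a b : Fin 3 → ℝ) : Prop := a ⬝ᵥ a = 1 ∧ b ⬝ᵥ b = 1 ∧ a ⬝ᵥ b = 0

lemma isCompact_unit : IsCompact {x : Fin 3 → ℝ | x ⬝ᵥ x = 1} := by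
  apply Metric.isCompact_of_isClosed_isBounded
  · exact isClosed_eq (by fun_prop) continuous_const
  · apply (Metric.isBounded_closedBall (x := (0 : Fin 3 → ℝ)) (r := 1)).subset
    intro x hx
    rw [mem_closedBall_zero_iff, pi_norm_le_iff_of_nonneg zero_le_one]
    intro i
    have hx' : x 0 * x 0 + x 1 * x 1 + x 2 * x 2 = 1 := by
      simpa [dotProduct, Fin.sum_univ_three] using hx
    rw [Real.norm_eq_abs, abs_le_one_iff_mul_self_le_one]
    fin_cases i <;> simp <;>
      nlinarith [mul_self_nonneg (x 0), mul_self_nonneg (x 1), mul_self_nonneg (x 2)]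

lemma isCompact_frames : IsCompact {p : (Fin 3 → ℝ) × (Fin 3 → ℝ) | IsFrame p.1 p.2} := by
  apply (isCompact_unit.prod isCompact_unit).of_isClosed_subset
  · apply IsClosed.inter (isClosed_eq (by fun_prop) continuous_const)
    exact IsClosed.inter (isClosed_eq (by fun_prop) continuous_const)
      (isClosed_eq (by fun_prop) continuous_const)
  · rintro ⟨a, b⟩ ⟨h1, h2, -⟩
    exact ⟨h1, h2⟩

lemma IsFrame.cpt_unit {a b : Fin 3 → ℝ} (h : IsFrame a b) (θ : ℝ) :
    cpt a b θ ⬝ᵥ cpt a b θ = 1 := by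
  obtain ⟨h1, h2, h3⟩ := h
  have h4 : b ⬝ᵥ a = 0 := by rw [dotProduct_comm, h3]
  simp only [cpt, add_dotProduct, dotProduct_add, smul_dotProduct, dotProduct_smul,
          h1, h2, h3, h4, smul_eq_mul]
  linear_combination Real.sin_sq_add_cos_sq θ

lemma IsFrame.cpt_frame {a b : Fin 3 → ℝ} (h : IsFrame a b) (θ : ℝ) :
    IsFrame (cpt a b θ) (cpt a b (θ + Real.pi / 2)) := by
  refine ⟨h.cpt_unit _, h.cpt_unit _, ?_⟩
  obtain ⟨h1, h2, h3⟩ := h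
  have h4 : b ⬝ᵥ a = 0 := by rw [dotProduct_comm, h3]
  simp only [cpt, add_dotProduct, dotProduct_add, smul_dotProduct, dotProduct_smul,
          h1, h2, h3, h4, smul_eq_mul, Real.cos_add_pi_div_two, Real.sin_add_pi_div_two]
  ring

section Pair

variable {ι : Type*}

/-- A family of symmetric functions of `F x` and `F (-x)` that determines the unordered pair
`{F x, F (-x)}`. -/
def pairInv (F : (Fin 3 → ℝ) → ι → ℝ) (x : Fin 3 → ℝ) (q : (ι × ι) × (ℝ × ℝ)) : ℝ :=
  (|F x q.1.1 - q.2.1| + |F x q.1.2 - q.2.2|) *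
    (|F (-x) q.1.1 - q.2.1| + |F (-x) q.1.2 - q.2.2|)

lemma pairInv_neg (F : (Fin 3 → ℝ) → ι → ℝ) (x : Fin 3 → ℝ) :
    pairInv F (-x) = pairInv F x := by
  ext q
  simp only [pairInv, neg_neg]
  ring

lemma continuous_pairInv {F : (Fin 3 → ℝ) → ι → ℝ} (hF : Continuous F) :
    Continuous (pairInv F) := by
  unfold pairInv
  refine continuous_pi fun q => ?_
  have h : ∀ i, Continuous fun x => F x i := fun i => (continuous_apply i).comp hF
  have h' : ∀ i, Continuous fun x => F (-x) i := fun i => (h i).comp continuous_neg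
  have h1 := h q.1.1
  have h2 := h q.1.2
  have h3 := h' q.1.1
  have h4 := h' q.1.2
  fun_prop

lemma eq_or_eq_neg_of_pairInv_eq {F G : (Fin 3 → ℝ) → ι → ℝ} {x y : Fin 3 → ℝ}
    (h : pairInv G y = pairInv F x) : G y = F x ∨ G y = F (-x) := by
  by_contra! hc
  obtain ⟨s, hs⟩ := Function.ne_iff.1 hc.1
  obtain ⟨t, ht⟩ := Function.ne_iff.1 hc.2
  have := congrFun h ((s, t), (G y s, G y t))
  simp only [pairInv, sub_self, abs_zero, add_zero, zero_mul] at this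
  have h1 : 0 < |F x s - G y s| := abs_pos.2 (sub_ne_zero.2 (Ne.symm hs))
  have h2 : 0 < |F (-x) t - G y t| := abs_pos.2 (sub_ne_zero.2 (Ne.symm ht))
  have h3 := abs_nonneg (F x t - G y t)
  have h4 := abs_nonneg (F (-x) s - G y s)
  have : 0 < (|F x s - G y s| + |F x t - G y t|) *
    (|F (-x) s - G y s| + |F (-x) t - G y t|) := by positivity
  linarith

/-- On every great circle `G` is obtained from `F` by an isometry of the circle. -/
def CircleCongr (F G : (Fin 3 → ℝ) → ι → ℝ) : Prop :=
  ∀ a b, IsFrame a b → ∃ ε α : ℝ, (ε = 1 ∨ ε = -1) ∧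
    ∀ θ, G (cpt a b θ) = F (cpt a b (ε * θ + α))

lemma neg_cpt_affine (a b : Fin 3 → ℝ) {ε : ℝ} (hε : ε = 1 ∨ ε = -1) (α θ : ℝ) :
    cpt a b (ε * (θ + Real.pi) + α) = -cpt a b (ε * θ + α) := by
  rcases hε with rfl | rfl
  · rw [← cpt_add_pi]; congr 1; ring
  · rw [← cpt_add_pi, ← cpt_periodic a b]; congr 1; ring

lemma CircleCongr.pairInv_eq {F G : (Fin 3 → ℝ) → ι → ℝ} (hF : Continuous F)
    (hG : Continuous G) (h : CircleCongr F G) {x : Fin 3 → ℝ} (hx : x ⬝ᵥ x = 1) :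
    pairInv G x = pairInv F x := by
  ext q
  have hFq : Continuous fun y => pairInv F y q := (continuous_apply q).comp (continuous_pairInv hF)
  have hGq : Continuous fun y => pairInv G y q := (continuous_apply q).comp (continuous_pairInv hG)
  rw [← sub_eq_zero]
  refine eq_zero_of_integral_great_circle (f := fun y => pairInv G y q - pairInv F y q)
    (hGq.sub hFq) (fun y => by simp only [pairInv_neg]) ?_ hx
  intro a b ha hb hab
  obtain ⟨ε, α, hε, hα⟩ := h a b ⟨ha, hb, hab⟩
  have hc : Continuous (cpt a b) := continuous_cpt continuous_const continuous_const continuous_id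
  have h1 : ∀ θ, pairInv G (cpt a b θ) q = pairInv F (cpt a b (ε * θ + α)) q := by
    intro θ
    have h2 := hα θ
    have h3 := hα (θ + Real.pi)
    rw [cpt_add_pi, neg_cpt_affine a b hε] at h3
    simp only [pairInv, h2, h3]
  have h4 := integral_periodic_comp (k := fun θ => pairInv F (cpt a b θ) q)
    (fun θ => by simp only [cpt_periodic a b θ]) hε α
  have hG' : Continuous fun θ => pairInv G (cpt a b θ) q := hGq.comp hc
  have hF' : Continuous fun θ => pairInv F (cpt a b θ) q := hFq.comp hc
  rw [intervalIntegral.integral_sub (hG'.intervalIntegrable _ _) (hF'.intervalIntegrable _ _)]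
  simp only [h1, h4, sub_self]

lemma symmetric_of_pairInv_const {F : (Fin 3 → ℝ) → ι → ℝ} (hF : Continuous F)
    {a b : Fin 3 → ℝ} (h : ∀ θ, pairInv F (cpt a b θ) = pairInv F (cpt a b 0)) (θ : ℝ) :
    F (cpt a b θ) = F (-cpt a b θ) := by
  by_contra hne
  obtain ⟨s, hs⟩ := Function.ne_iff.1 hne
  have hc : Continuous fun ψ => F (cpt a b ψ) s :=
    (continuous_apply s).comp
      (hF.comp (continuous_cpt continuous_const continuous_const continuous_id))
  have htwo : ∀ ψ, F (cpt a b ψ) s = F (cpt a b θ) s ∨ F (cpt a b ψ) s = F (-cpt a b θ) s := by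
    intro ψ
    rcases eq_or_eq_neg_of_pairInv_eq ((h ψ).trans (h θ).symm) with h1 | h1
    · left; rw [h1]
    · right; rw [h1]
  have hmid := intermediate_value_uIcc (a := θ) (b := θ + Real.pi) hc.continuousOn
  rw [cpt_add_pi] at hmid
  have hin : (F (cpt a b θ) s + F (-cpt a b θ) s) / 2 ∈
      Set.uIcc (F (cpt a b θ) s) (F (-cpt a b θ) s) := by
    rw [Set.mem_uIcc]
    rcases le_total (F (cpt a b θ) s) (F (-cpt a b θ) s) with h | h
    · left; constructor <;> linarith
    · right; constructor <;> linarith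
  obtain ⟨ψ, -, hψ⟩ := hmid hin
  simp only at hψ
  rcases htwo ψ with h1 | h1 <;> rw [hψ] at h1 <;> apply hs <;> linarith

end Pair

section Periods

variable {M : Type*} {H : (Fin 3 → ℝ) → M}

/-- The periods of `H` along the great circle spanned by `a`, `b`. -/
def periods (H : (Fin 3 → ℝ) → M) (a b : Fin 3 → ℝ) : AddSubgroup ℝ where
  carrier := {α | ∀ θ, H (cpt a b (θ + α)) = H (cpt a b θ)}
  zero_mem' := by simp
  add_mem' := by
    intro x y hx hy θ
    rw [← add_assoc, hy, hx]
  neg_mem' := by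
    intro x hx θ
    rw [← hx (θ + -x), neg_add_cancel_right]

variable [TopologicalSpace M] [T2Space M]

/-- The periods of a continuous function that is constant on no great circle are bounded
away from zero. -/
lemma exists_pos_le_periods (hH : Continuous H)
    (hne : ∀ a b, IsFrame a b → ∃ θ, H (cpt a b θ) ≠ H (cpt a b 0)) :
    ∃ δ > 0, ∀ a b, IsFrame a b → ∀ α ∈ periods H a b, 0 < α → δ ≤ α := by
  by_contra! hcon
  choose a b hab α hα hpos hlt using fun n : ℕ => hcon (1 / ((n : ℝ) + 1)) (by positivity)
  obtain ⟨⟨a₀, b₀⟩, h₀, σ, hσ, hlim⟩ :=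
    isCompact_frames.tendsto_subseq (x := fun n => (a n, b n)) hab
  obtain ⟨θ, hθ⟩ := hne a₀ b₀ h₀
  apply hθ
  have hα0 : Tendsto α atTop (𝓝 0) :=
    squeeze_zero (fun n => (hpos n).le) (fun n => (hlt n).le)
      tendsto_one_div_add_atTop_nhds_zero_nat
  have hk : Tendsto (fun n => (⌊θ / α (σ n)⌋ : ℝ) * α (σ n)) atTop (𝓝 θ) := by
    rw [tendsto_iff_dist_tendsto_zero]
    refine squeeze_zero (fun n => dist_nonneg) (fun n => ?_) (hα0.comp hσ.tendsto_atTop)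
    have hp := hpos (σ n)
    have h1 := Int.floor_le (θ / α (σ n))
    have h2 := Int.lt_floor_add_one (θ / α (σ n))
    rw [le_div_iff₀ hp] at h1
    rw [div_lt_iff₀ hp] at h2
    rw [Real.dist_eq, abs_le, Function.comp]
    constructor <;> nlinarith
  have hcont : Continuous fun p : ((Fin 3 → ℝ) × (Fin 3 → ℝ)) × ℝ => H (cpt p.1.1 p.1.2 p.2) :=
    hH.comp (continuous_cpt (by fun_prop) (by fun_prop) (by fun_prop))
  have l1 := (hcont.tendsto ((a₀, b₀), θ)).comp (hlim.prodMk_nhds hk)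
  have l2 := (hcont.tendsto ((a₀, b₀), 0)).comp (hlim.prodMk_nhds tendsto_const_nhds)
  refine tendsto_nhds_unique l1 (l2.congr fun n => ?_)
  have hm : (⌊θ / α (σ n)⌋ : ℝ) * α (σ n) ∈ periods H (a (σ n)) (b (σ n)) := by
    rw [← zsmul_eq_mul]
    exact AddSubgroup.zsmul_mem _ (hα _) _
  have := hm 0
  rw [zero_add] at this
  exact this.symm

lemma exists_common_period (hH : Continuous H)
    (hne : ∀ a b, IsFrame a b → ∃ θ, H (cpt a b θ) ≠ H (cpt a b 0)) :
    ∃ N : ℕ, 0 < N ∧ ∀ a b, IsFrame a b → ∀ α ∈ periods H a b, ∃ m : ℤ,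
      N * α = m * (2 * Real.pi) := by
  obtain ⟨δ, hδ, h⟩ := exists_pos_le_periods hH hne
  have hpi := Real.pi_pos
  refine ⟨(⌈2 * Real.pi / δ⌉₊).factorial, Nat.factorial_pos _, fun a b hab α hα => ?_⟩
  obtain ⟨g, hg⟩ := AddSubgroup.cyclic_of_isolated_zero (H := periods H a b) hδ (by
    rw [Set.disjoint_left]
    intro x hx hx'
    exact absurd (h a b hab x hx hx'.1) (not_le.2 hx'.2))
  have h2pi : 2 * Real.pi ∈ periods H a b := fun θ => by rw [cpt_periodic a b θ]
  have hgm : g ∈ periods H a b := by rw [hg]; exact AddSubgroup.subset_closure rfl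
  rw [hg, AddSubgroup.mem_closure_singleton] at h2pi hα
  obtain ⟨n, hn⟩ := h2pi
  obtain ⟨m, hm⟩ := hα
  rw [zsmul_eq_mul] at hn hm
  have hg0 : g ≠ 0 := by rintro rfl; simp at hn
  have hgδ : δ ≤ |g| := by
    rcases lt_or_gt_of_ne hg0 with h0 | h0
    · rw [abs_of_neg h0]
      exact h a b hab _ (neg_mem hgm) (by linarith)
    · rw [abs_of_pos h0]
      exact h a b hab _ hgm h0
  have hn0 : n ≠ 0 := by rintro rfl; simp at hn
  have hle : n.natAbs ≤ ⌈2 * Real.pi / δ⌉₊ := by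
    have : (n.natAbs : ℝ) ≤ 2 * Real.pi / δ := by
      rw [le_div_iff₀ hδ, Nat.cast_natAbs, Int.cast_abs]
      have h3 : |(n:ℝ)| * |g| = 2 * Real.pi := by rw [← abs_mul, hn, abs_of_pos (by positivity)]
      rw [← h3]
      exact mul_le_mul_of_nonneg_left hgδ (abs_nonneg _)
    exact_mod_cast this.trans (Nat.le_ceil _)
  have hdvd : n ∣ (((⌈2 * Real.pi / δ⌉₊).factorial : ℕ) : ℤ) := by
    rw [← Int.natAbs_dvd_natAbs, Int.natAbs_natCast]
    exact Nat.dvd_factorial (Int.natAbs_pos.2 hn0) hle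
  obtain ⟨k, hk⟩ := hdvd
  refine ⟨k * m, ?_⟩
  have hk' : (((⌈2 * Real.pi / δ⌉₊).factorial : ℕ) : ℝ) = n * k := by exact_mod_cast hk
  rw [hk', ← hm, ← hn]
  push_cast
  ring

end Periods

/-- The polar unit tangent vector of spherical coordinates. -/
def sphA (t φ : ℝ) : Fin 3 → ℝ :=
  ![Real.cos t * Real.cos φ, Real.cos t * Real.sin φ, -Real.sin t]

/-- The azimuthal unit tangent vector of spherical coordinates. -/
def sphB (φ : ℝ) : Fin 3 → ℝ := ![-Real.sin φ, Real.cos φ, 0]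

lemma isFrame_sph (t φ : ℝ) : IsFrame (sphA t φ) (sphB φ) := by
  have h1 := Real.sin_sq_add_cos_sq t
  have h2 := Real.sin_sq_add_cos_sq φ
  refine ⟨?_, ?_, ?_⟩ <;> simp [sphA, sphB, dotProduct, Fin.sum_univ_three]
  · linear_combination (Real.cos t) ^ 2 * h2 + h1
  · linear_combination h2
  · ring

lemma continuous_sphA {X : Type*} [TopologicalSpace X] {t φ : X → ℝ} (ht : Continuous t)
    (hφ : Continuous φ) : Continuous fun x => sphA (t x) (φ x) := by
  unfold sphA
  refine continuous_pi fun i => ?_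
  fin_cases i <;> simp <;> fun_prop

lemma continuous_sphB {X : Type*} [TopologicalSpace X] {φ : X → ℝ}
    (hφ : Continuous φ) : Continuous fun x => sphB (φ x) := by
  unfold sphB
  refine continuous_pi fun i => ?_
  fin_cases i <;> simp <;> fun_prop

lemma cpt_sph_zero (φ θ : ℝ) :
    cpt (sphA 0 φ) (sphB φ) θ = cpt (sphA 0 0) (sphB 0) (θ + φ) := by
  ext i
  fin_cases i <;> simp [cpt, sphA, sphB, Real.cos_add, Real.sin_add] <;> ring

lemma cpt_sph_pi (φ θ : ℝ) :
    cpt (sphA Real.pi φ) (sphB φ) θ = cpt (sphA Real.pi 0) (sphB 0) (θ - φ) := by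
  ext i
  fin_cases i <;> simp [cpt, sphA, sphB, Real.cos_sub, Real.sin_sub] <;> ring

lemma eq_of_continuous_of_mem_two_pi_int {f : ℝ → ℝ} (hf : Continuous f)
    (h : ∀ t, ∃ m : ℤ, f t = m * (2 * Real.pi)) (s t : ℝ) : f s = f t := by
  wlog hlt : f s < f t generalizing s t
  · rcases lt_trichotomy (f s) (f t) with h1 | h1 | h1
    · exact this s t h1
    · exact h1
    · exact (this t s h1).symm
  have hpi := Real.pi_pos
  obtain ⟨m, hm⟩ := h s
  obtain ⟨n, hn⟩ := h t
  have hmn : (m : ℝ) < n := by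
    rw [hm, hn] at hlt
    exact lt_of_mul_lt_mul_right hlt (by positivity)
  have hmn' : (m : ℝ) + 1 ≤ n := by exact_mod_cast Int.add_one_le_of_lt (by exact_mod_cast hmn)
  have hin : f s + Real.pi ∈ Set.uIcc (f s) (f t) := by
    rw [Set.mem_uIcc]
    left
    constructor
    · linarith
    · rw [hm, hn]; nlinarith
  obtain ⟨u, -, hu⟩ := intermediate_value_uIcc hf.continuousOn hin
  obtain ⟨k, hk⟩ := h u
  rw [hk, hm] at hu
  have h2 : Real.pi * (2 * (k : ℝ)) = Real.pi * (2 * m + 1) := by linarith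
  have h3 := mul_left_cancel₀ hpi.ne' h2
  have h4 : 2 * k = 2 * m + 1 := by exact_mod_cast h3
  omega

lemma circle_exp_eq_iff {x y : ℝ} : Circle.exp x = Circle.exp y ↔
    ∃ m : ℤ, x = y + m * (2 * Real.pi) := Circle.exp_eq_exp

/-- A continuous function on the sphere that has a reflection symmetry on every great circle
is constant on some great circle. -/
lemma not_forall_exists_reflection {M : Type*} [TopologicalSpace M] [T2Space M]
    {H : (Fin 3 → ℝ) → M} (hH : Continuous H)
    (hne : ∀ a b, IsFrame a b → ∃ θ, H (cpt a b θ) ≠ H (cpt a b 0))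
    (hB : ∀ a b, IsFrame a b → ∃ β, ∀ θ, H (cpt a b (β - θ)) = H (cpt a b θ)) : False := by
  have hpi := Real.pi_pos
  obtain ⟨N, hN, hper⟩ := exists_common_period hH hne
  have hB' : ∀ p : ℝ × ℝ, ∃ β ∈ Set.Icc 0 (2 * Real.pi),
      ∀ θ, H (cpt (sphA p.1 p.2) (sphB p.2) (β - θ)) = H (cpt (sphA p.1 p.2) (sphB p.2) θ) := by
    intro p
    obtain ⟨β, hβ⟩ := hB _ _ (isFrame_sph p.1 p.2)
    have hmem := toIcoMod_mem_Ico' (show 0 < 2 * Real.pi by positivity) β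
    refine ⟨toIcoMod (show 0 < 2 * Real.pi by positivity) 0 β, ⟨hmem.1, hmem.2.le⟩, fun θ => ?_⟩
    rw [← hβ θ, toIcoMod, sub_right_comm, (cpt_periodic _ _).sub_zsmul_eq]
  choose β hβI hβ using hB'
  have huniq : ∀ p : ℝ × ℝ, ∀ γ,
      (∀ θ, H (cpt (sphA p.1 p.2) (sphB p.2) (γ - θ)) = H (cpt (sphA p.1 p.2) (sphB p.2) θ)) →
      Circle.exp (N * γ) = Circle.exp (N * β p) := by
    intro p γ hγ
    obtain ⟨m, hm⟩ := hper _ _ (isFrame_sph p.1 p.2) (γ - β p) (fun θ => by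
      rw [← hγ, ← hβ p]
      congr 2
      ring)
    exact circle_exp_eq_iff.2 ⟨m, by linarith⟩
  set Z : ℝ × ℝ → Circle := fun p => Circle.exp (N * β p) with hZ
  have hexpc : Continuous fun x : ℝ => Circle.exp (N * x) :=
    Circle.exp.continuous.comp (continuous_const.mul continuous_id)
  have hZc : Continuous Z := by
    rw [continuous_iff_seqContinuous]
    intro u p hu
    refine tendsto_of_subseq_tendsto fun ns hns => ?_
    obtain ⟨γ, -, ms, hms, hlim⟩ :=
      isCompact_Icc.tendsto_subseq (x := fun n => β (u (ns n))) fun n => hβI _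
    refine ⟨ms, ?_⟩
    have hu' := (hu.comp hns).comp hms.tendsto_atTop
    have hγ : Circle.exp (N * γ) = Z p := by
      refine huniq p γ fun θ => ?_
      have hc1 : Continuous fun q : (ℝ × ℝ) × ℝ =>
          H (cpt (sphA q.1.1 q.1.2) (sphB q.1.2) (q.2 - θ)) :=
        hH.comp (continuous_cpt (continuous_sphA (by fun_prop) (by fun_prop))
          (continuous_sphB (by fun_prop)) (by fun_prop))
      have hc2 : Continuous fun q : ℝ × ℝ => H (cpt (sphA q.1 q.2) (sphB q.2) θ) :=
        hH.comp (continuous_cpt (continuous_sphA (by fun_prop) (by fun_prop))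
          (continuous_sphB (by fun_prop)) (by fun_prop))
      exact tendsto_nhds_unique ((hc1.tendsto (p, γ)).comp (hu'.prodMk_nhds hlim))
        (((hc2.tendsto p).comp hu').congr fun n => (hβ _ θ).symm)
    rw [← hγ]
    exact (hexpc.tendsto γ).comp hlim
  obtain ⟨Λ, ⟨-, hΛ⟩, -⟩ := Circle.isCoveringMap_exp.existsUnique_continuousMap_lifts
    (⟨Z, hZc⟩ : C(ℝ × ℝ, Circle)) (0, 0) (N * β (0, 0)) rfl
  have hΛ' : ∀ p, Circle.exp (Λ p) = Z p := fun p => congrFun hΛ p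
  have hΛc := Λ.continuous
  have hclose : ∀ t, Λ (t, 2 * Real.pi) - Λ (t, 0) = Λ (0, 2 * Real.pi) - Λ (0, 0) := by
    intro t
    refine eq_of_continuous_of_mem_two_pi_int
      (f := fun t => Λ (t, 2 * Real.pi) - Λ (t, 0)) (by fun_prop) (fun s => ?_) t 0
    have : Circle.exp (Λ (s, 2 * Real.pi)) = Circle.exp (Λ (s, 0)) := by
      rw [hΛ', hΛ']
      refine huniq (s, 0) (β (s, 2 * Real.pi)) fun θ => ?_
      have := hβ (s, 2 * Real.pi) θ
      simpa [sphA, sphB] using this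
    obtain ⟨m, hm⟩ := circle_exp_eq_iff.1 this
    exact ⟨m, by linarith⟩
  have hpole : ∀ t σ : ℝ, (∀ φ θ, cpt (sphA t φ) (sphB φ) θ = cpt (sphA t 0) (sphB 0) (θ + σ * φ)) →
      Λ (t, 2 * Real.pi) - Λ (t, 0) = - (2 * N * σ * (2 * Real.pi)) := by
    intro t σ h
    have h1 := eq_of_continuous_of_mem_two_pi_int
      (f := fun φ => Λ (t, φ) + 2 * N * σ * φ - Λ (t, 0)) (by fun_prop) (fun φ => ?_)
      (2 * Real.pi) 0
    · simp only [mul_zero, add_zero, sub_self] at h1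
      linarith
    · have : Circle.exp (N * (β (t, φ) + 2 * σ * φ)) = Circle.exp (Λ (t, 0)) := by
        rw [hΛ']
        refine huniq (t, 0) _ fun θ => ?_
        have h2 : H (cpt (sphA t φ) (sphB φ) (β (t, φ) - (θ - σ * φ))) =
            H (cpt (sphA t φ) (sphB φ) (θ - σ * φ)) := hβ (t, φ) _
        rw [h φ (β (t, φ) - (θ - σ * φ)), h φ (θ - σ * φ), sub_add_cancel] at h2
        rw [← h2]
        congr 2
        ring
      obtain ⟨m, hm⟩ := circle_exp_eq_iff.1 this
      obtain ⟨n, hn⟩ := circle_exp_eq_iff.1 (hΛ' (t, φ))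
      refine ⟨m + n, ?_⟩
      push_cast
      linarith
  have h0 := hpole 0 1 fun φ θ => by rw [cpt_sph_zero, one_mul]
  have hp := hpole Real.pi (-1) fun φ θ => by rw [cpt_sph_pi]; congr 1; ring
  have := hclose Real.pi
  rw [h0, hp] at this
  have hN' : (0 : ℝ) < N := by exact_mod_cast hN
  have : (0:ℝ) < N * Real.pi := by positivity
  nlinarith

/-- The point of latitude `μ` and longitude `θ` with respect to the equatorial frame `(a, b)`. -/
def latPt (a b : Fin 3 → ℝ) (θ μ : ℝ) : Fin 3 → ℝ :=
  Real.cos μ • cpt a b θ + Real.sin μ • (a ⨯₃ b)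

lemma latPt_zero (a b : Fin 3 → ℝ) (θ : ℝ) : latPt a b θ 0 = cpt a b θ := by
  simp [latPt]

lemma IsFrame.cross_unit {a b : Fin 3 → ℝ} (h : IsFrame a b) : (a ⨯₃ b) ⬝ᵥ (a ⨯₃ b) = 1 := by
  obtain ⟨h1, h2, h3⟩ := h
  rw [cross_dot_cross, h1, h2, h3]
  ring

lemma IsFrame.latPt_dot {a b : Fin 3 → ℝ} (h : IsFrame a b) (θ ψ μ ν : ℝ) :
    latPt a b θ μ ⬝ᵥ latPt a b ψ ν =
      Real.cos μ * Real.cos ν * Real.cos (ψ - θ) + Real.sin μ * Real.sin ν := by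
  have h5 := h.cross_unit
  obtain ⟨h1, h2, h3⟩ := h
  have h4 : b ⬝ᵥ a = 0 := by rw [dotProduct_comm, h3]
  have h6 : a ⬝ᵥ (a ⨯₃ b) = 0 := dot_self_cross a b
  have h7 : b ⬝ᵥ (a ⨯₃ b) = 0 := dot_cross_self a b
  have h8 : (a ⨯₃ b) ⬝ᵥ a = 0 := by rw [dotProduct_comm, h6]
  have h9 : (a ⨯₃ b) ⬝ᵥ b = 0 := by rw [dotProduct_comm, h7]
  simp only [latPt, cpt, add_dotProduct, dotProduct_add, smul_dotProduct, dotProduct_smul,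
    smul_eq_mul, smul_add, h1, h2, h3, h4, h5, h6, h7, h8, h9, Real.cos_sub]
  ring

lemma IsFrame.latPt_cross_dot {a b : Fin 3 → ℝ} (h : IsFrame a b) (θ ψ μ ν : ℝ) :
    (latPt a b θ μ ⨯₃ latPt a b ψ ν) ⬝ᵥ (a ⨯₃ b) =
      Real.cos μ * Real.cos ν * Real.sin (ψ - θ) := by
  obtain ⟨h1, h2, h3⟩ := h
  have h4 : b ⬝ᵥ a = 0 := by rw [dotProduct_comm, h3]
  have h6 : (a ⨯₃ b) ⬝ᵥ a = 0 := by rw [dotProduct_comm]; exact dot_self_cross a b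
  have h7 : (a ⨯₃ b) ⬝ᵥ b = 0 := by rw [dotProduct_comm]; exact dot_cross_self a b
  rw [cross_dot_cross]
  simp only [latPt, cpt, add_dotProduct, smul_dotProduct,
    smul_eq_mul, smul_add, h1, h2, h3, h4, h6, h7, Real.sin_sub]
  ring

/-- If points at spherical distance `arccos k` are identified by `H` along all great circles whose
axis is close to that of the frame `(a, b)`, then `H` has arbitrarily small periods along the
great circle of `(a, b)`. -/
lemma exists_small_period {M : Type*} {H : (Fin 3 → ℝ) → M} {a b : Fin 3 → ℝ} (hab : IsFrame a b)
    {k c : ℝ} (hk1 : -1 < k) (hk2 : k < 1) (hc : c < 1)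
    (hH : ∀ x y : Fin 3 → ℝ, x ⬝ᵥ x = 1 → y ⬝ᵥ y = 1 → x ⬝ᵥ y = k →
      c * √(1 - k ^ 2) < (x ⨯₃ y) ⬝ᵥ (a ⨯₃ b) → H x = H y) {δ : ℝ} (hδ : 0 < δ) :
    ∃ α ∈ periods H a b, 0 < α ∧ α < δ := by
  have hs : 0 < √(1 - k ^ 2) := Real.sqrt_pos.2 (by nlinarith)
  have hunit : ∀ θ μ, latPt a b θ μ ⬝ᵥ latPt a b θ μ = 1 := by
    intro θ μ
    rw [hab.latPt_dot, sub_self, Real.cos_zero]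
    have := Real.sin_sq_add_cos_sq μ
    linear_combination this
  have hstep : ∀ μ ν D, Real.cos μ * Real.cos ν * Real.cos D + Real.sin μ * Real.sin ν = k →
      c * √(1 - k ^ 2) < Real.cos μ * Real.cos ν * Real.sin D →
      ∀ θ, H (latPt a b θ μ) = H (latPt a b (θ + D) ν) := by
    intro μ ν D h1 h2 θ
    refine hH _ _ (hunit _ _) (hunit _ _) ?_ ?_
    · rw [hab.latPt_dot, add_sub_cancel_left, h1]
    · rwa [hab.latPt_cross_dot, add_sub_cancel_left]
  have hu1 : Tendsto (fun μ => k / Real.cos μ) (𝓝 0) (𝓝 k) := by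
    have : ContinuousAt (fun μ => k / Real.cos μ) 0 :=
      continuousAt_const.div Real.continuous_cos.continuousAt (by simp)
    simpa using this.tendsto
  have hu2 : ∀ s : ℝ, Tendsto (fun μ => (k + s * Real.sin μ ^ 2) / Real.cos μ ^ 2) (𝓝 0) (𝓝 k) := by
    intro s
    have : ContinuousAt (fun μ => (k + s * Real.sin μ ^ 2) / Real.cos μ ^ 2) 0 :=
      ContinuousAt.div (by fun_prop) (by fun_prop) (by simp)
    simpa using this.tendsto
  have key : ∀ {u : ℝ → ℝ} {m n : ℝ → ℝ}, Tendsto u (𝓝 0) (𝓝 k) → Continuous m → Continuous n →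
      m 0 = 0 → n 0 = 0 → ∀ᶠ μ in 𝓝 0, Real.cos (Real.arccos (u μ)) = u μ ∧
        c * √(1 - k ^ 2) < Real.cos (m μ) * Real.cos (n μ) * Real.sin (Real.arccos (u μ)) := by
    intro u m n hu hm hn hm0 hn0
    have h1 : Tendsto (fun μ => Real.cos (m μ) * Real.cos (n μ) * Real.sin (Real.arccos (u μ)))
        (𝓝 0) (𝓝 (√(1 - k ^ 2))) := by
      have hm' : Tendsto (fun μ => Real.cos (m μ)) (𝓝 0) (𝓝 1) := by
        have : Continuous fun μ => Real.cos (m μ) := by fun_prop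
        simpa [hm0] using this.tendsto 0
      have hn' : Tendsto (fun μ => Real.cos (n μ)) (𝓝 0) (𝓝 1) := by
        have : Continuous fun μ => Real.cos (n μ) := by fun_prop
        simpa [hn0] using this.tendsto 0
      have hs' : Tendsto (fun μ => Real.sin (Real.arccos (u μ))) (𝓝 0) (𝓝 (√(1 - k ^ 2))) := by
        rw [← Real.sin_arccos]
        exact ((Real.continuous_sin.comp Real.continuous_arccos).tendsto k).comp hu
      simpa using (hm'.mul hn').mul hs'
    filter_upwards [hu.eventually (lt_mem_nhds hk1), hu.eventually (gt_mem_nhds hk2),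
      h1.eventually (lt_mem_nhds (show c * √(1 - k ^ 2) < √(1 - k ^ 2) by nlinarith))]
      with μ h2 h3 h4
    exact ⟨Real.cos_arccos h2.le h3.le, h4⟩
  have hdiff : Tendsto (fun μ => Real.arccos ((k + (-1) * Real.sin μ ^ 2) / Real.cos μ ^ 2) -
      Real.arccos ((k + 1 * Real.sin μ ^ 2) / Real.cos μ ^ 2)) (𝓝 0) (𝓝 0) := by
    have h1 := (Real.continuous_arccos.tendsto k).comp (hu2 (-1))
    have h2 := (Real.continuous_arccos.tendsto k).comp (hu2 1)
    simpa using h1.sub h2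
  have hcos : ∀ᶠ μ in 𝓝 (0 : ℝ), 0 < Real.cos μ := by
    have := Real.continuous_cos.tendsto 0
    rw [Real.cos_zero] at this
    exact this.eventually (lt_mem_nhds one_pos)
  have hsin : ∀ᶠ μ in 𝓝[≠] (0 : ℝ), Real.sin μ ≠ 0 := by
    have h1 : ∀ᶠ μ in 𝓝[≠] (0 : ℝ), μ ∈ Set.Ioo (-Real.pi) Real.pi :=
      nhdsWithin_le_nhds (Ioo_mem_nhds (by linarith [Real.pi_pos]) Real.pi_pos)
    filter_upwards [h1, self_mem_nhdsWithin] with μ h2 h3 h4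
    exact h3 ((Real.sin_eq_zero_iff_of_lt_of_lt h2.1 h2.2).1 h4)
  have hall := ((key (m := fun _ => 0) (n := fun μ => μ) hu1 (by fun_prop) (by fun_prop)
    rfl rfl).and
    ((key (m := fun _ => 0) (n := fun μ => -μ) hu1 (by fun_prop) (by fun_prop) rfl neg_zero).and
    ((key (m := fun μ => μ) (n := fun μ => μ) (hu2 (-1)) (by fun_prop) (by fun_prop) rfl rfl).and
    ((key (m := fun μ => μ) (n := fun μ => -μ) (hu2 1) (by fun_prop) (by fun_prop) rfl neg_zero).and
    (hcos.and (hdiff.eventually (Metric.ball_mem_nhds 0 hδ)))))))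
  obtain ⟨μ, ⟨⟨hE, hE1⟩, ⟨-, hE2⟩, ⟨hD0, hD0'⟩, ⟨hD1, hD1'⟩, hcμ, hd⟩, hsμ⟩ :=
    ((hall.filter_mono nhdsWithin_le_nhds).and hsin).exists
  set E := Real.arccos (k / Real.cos μ)
  set D0 := Real.arccos ((k + (-1) * Real.sin μ ^ 2) / Real.cos μ ^ 2)
  set D1 := Real.arccos ((k + 1 * Real.sin μ ^ 2) / Real.cos μ ^ 2)
  have s1 := hstep 0 μ E (by rw [hE]; simp; field_simp) hE1
  have s2 := hstep 0 (-μ) E (by rw [hE]; simp; field_simp) hE2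
  have s3 := hstep μ μ D0 (by rw [hD0]; field_simp; ring) hD0'
  have s4 := hstep μ (-μ) D1 (by rw [hD1]; simp; field_simp; ring) hD1'
  have hper : D1 - D0 ∈ periods H a b := by
    intro θ
    have e1 := s1 θ
    have e2 := s3 (θ + E - D0)
    have e3 := s4 (θ + E - D0)
    have e4 := s2 (θ + (D1 - D0))
    rw [sub_add_cancel] at e2
    rw [latPt_zero] at e1 e4
    rw [e1, ← e2, e3, e4]
    congr 2
    ring
  have hne : D1 - D0 ≠ 0 := by
    intro h0
    have : Real.cos D1 = Real.cos D0 := by rw [sub_eq_zero.1 h0]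
    rw [hD0, hD1, div_left_inj' (by positivity)] at this
    have : Real.sin μ ^ 2 = 0 := by linarith
    exact hsμ (by simpa using this)
  have habs : |D1 - D0| < δ := by
    have : |D0 - D1| < δ := by simpa [Real.dist_eq] using hd
    rwa [abs_sub_comm]
  rcases hne.lt_or_gt with h | h
  · exact ⟨-(D1 - D0), neg_mem hper, by linarith, by rwa [← abs_of_neg h]⟩
  · exact ⟨D1 - D0, hper, h, by rwa [← abs_of_pos h]⟩

/-- The unit sphere of `ℝ³`. -/
abbrev UnitSph : Type := {x : Fin 3 → ℝ // x ⬝ᵥ x = 1}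

instance : CompactSpace UnitSph := isCompact_iff_compactSpace.1 isCompact_unit

lemma dotProduct_self_pos {x : Fin 3 → ℝ} (hx : x ≠ 0) : 0 < x ⬝ᵥ x := by
  refine lt_of_le_of_ne ?_ fun h => hx (dotProduct_self_eq_zero.1 h.symm)
  exact Finset.sum_nonneg fun i _ => mul_self_nonneg _

instance : PreconnectedSpace UnitSph := by
  refine Subtype.preconnectedSpace (s := {x : Fin 3 → ℝ | x ⬝ᵥ x = 1}) ?_
  have h1 : IsPreconnected ({0}ᶜ : Set (Fin 3 → ℝ)) :=
    (isConnected_compl_singleton_of_one_lt_rank (by simp) 0).isPreconnected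
  have hpos : ∀ x : Fin 3 → ℝ, x ≠ 0 → 0 < x ⬝ᵥ x := fun x hx => dotProduct_self_pos hx
  have hsq : Continuous fun x : Fin 3 → ℝ => √(x ⬝ᵥ x) :=
    Real.continuous_sqrt.comp (continuous_id.dotProduct continuous_id)
  have h2 := h1.image (fun x => (√(x ⬝ᵥ x))⁻¹ • x) (by
    refine ContinuousOn.smul (ContinuousOn.inv₀ hsq.continuousOn fun x hx => ?_) continuousOn_id
    exact (Real.sqrt_pos.2 (hpos x hx)).ne')
  convert h2 using 1
  ext x
  constructor
  · intro hx
    refine ⟨x, ?_, by simp [show x ⬝ᵥ x = 1 from hx]⟩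
    rintro rfl
    simp at hx
  · rintro ⟨y, hy, rfl⟩
    have h3 := hpos y hy
    have h4 := Real.sqrt_pos.2 h3
    simp only [Set.mem_ofPred_eq, smul_dotProduct, dotProduct_smul, smul_eq_mul]
    field_simp
    rw [Real.sq_sqrt h3.le]

lemma isClosed_forall_perp {Q : Type*} [TopologicalSpace Q] {w : Q → Fin 3 → ℝ}
    (hw : Continuous w) (hu : ∀ q, w q ⬝ᵥ w q = 1) {P : Q → (Fin 3 → ℝ) → Prop}
    (hP : IsClosed {p : Q × (Fin 3 → ℝ) | P p.1 p.2}) :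
    IsClosed {q | ∀ x, x ⬝ᵥ x = 1 → x ⬝ᵥ w q = 0 → P q x} := by
  set v : (Fin 3 → ℝ) → Q → Fin 3 → ℝ := fun x q => x - (x ⬝ᵥ w q) • w q with hv
  have hvc : ∀ x, Continuous (v x) := fun x => by
    refine continuous_const.sub (Continuous.smul (continuous_const.dotProduct hw) hw)
  have hvw : ∀ x q, v x q ⬝ᵥ w q = 0 := fun x q => by simp [hv, sub_dotProduct, hu]
  have hset : {q | ∀ x, x ⬝ᵥ x = 1 → x ⬝ᵥ w q = 0 → P q x} =
      ⋂ x, {q | v x q = 0 ∨ P q ((√(v x q ⬝ᵥ v x q))⁻¹ • v x q)} := by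
    ext q
    simp only [Set.mem_ofPred_eq, Set.mem_iInter]
    constructor
    · intro h x
      by_cases h0 : v x q = 0
      · exact Or.inl h0
      have h3 : 0 < v x q ⬝ᵥ v x q := dotProduct_self_pos h0
      have h4 := Real.sqrt_pos.2 h3
      refine Or.inr (h _ ?_ ?_)
      · simp only [smul_dotProduct, dotProduct_smul, smul_eq_mul]
        field_simp
        rw [Real.sq_sqrt h3.le]
      · rw [smul_dotProduct, hvw, smul_zero]
    · intro h x hx hxw
      have hvx : v x q = x := by simp [hv, hxw]
      have := h x
      rw [hvx, hx] at this
      rcases this with rfl | this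
      · simp at hx
      · simpa using this
  rw [hset]
  refine isClosed_iInter fun x => ?_
  rw [← isOpen_compl_iff]
  have hopen : IsOpen {q | v x q ≠ 0} := isOpen_ne_fun (hvc x) continuous_const
  have hc : ContinuousOn (fun q => (q, (√(v x q ⬝ᵥ v x q))⁻¹ • v x q)) {q | v x q ≠ 0} := by
    have hi : ContinuousOn (fun q => (√(v x q ⬝ᵥ v x q))⁻¹) {q | v x q ≠ 0} := by
      refine ContinuousOn.inv₀ ?_ fun q hq => (Real.sqrt_pos.2 (dotProduct_self_pos hq)).ne'
      exact (Real.continuous_sqrt.comp ((hvc x).dotProduct (hvc x))).continuousOn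
    exact continuousOn_id.prodMk (hi.smul (hvc x).continuousOn)
  convert hc.isOpen_inter_preimage hopen hP.isOpen_compl using 1
  ext q
  simp [not_or]

/-- Rotation by the angle `r` about `w` of a vector orthogonal to `w`. -/
def rotAbout (w : Fin 3 → ℝ) (r : ℝ) (x : Fin 3 → ℝ) : Fin 3 → ℝ :=
  Real.cos r • x + Real.sin r • (w ⨯₃ x)

lemma continuous_rotAbout {X : Type*} [TopologicalSpace X] {w x : X → Fin 3 → ℝ} {r : X → ℝ}
    (hw : Continuous w) (hr : Continuous r) (hx : Continuous x) :
    Continuous fun p => rotAbout (w p) (r p) (x p) := by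
  have h : Continuous fun p => w p ⨯₃ x p := by
    simp only [cross_apply]
    refine continuous_pi fun i => ?_
    fin_cases i <;> simp <;> fun_prop
  unfold rotAbout
  exact ((Real.continuous_cos.comp hr).smul hx).add ((Real.continuous_sin.comp hr).smul h)

lemma IsFrame.expand {a b : Fin 3 → ℝ} (h : IsFrame a b) (x : Fin 3 → ℝ) :
    x = (a ⬝ᵥ x) • a + (b ⬝ᵥ x) • b + ((a ⨯₃ b) ⬝ᵥ x) • (a ⨯₃ b) := by
  have h5 := h.cross_unit
  obtain ⟨h1, h2, h3⟩ := h
  have h4 : b ⬝ᵥ a = 0 := by rw [dotProduct_comm, h3]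
  have h6 : a ⬝ᵥ (a ⨯₃ b) = 0 := dot_self_cross a b
  have h7 : b ⬝ᵥ (a ⨯₃ b) = 0 := dot_cross_self a b
  have h8 : (a ⨯₃ b) ⬝ᵥ a = 0 := by rw [dotProduct_comm, h6]
  have h9 : (a ⨯₃ b) ⬝ᵥ b = 0 := by rw [dotProduct_comm, h7]
  set c := a ⨯₃ b
  set A : Matrix (Fin 3) (Fin 3) ℝ := Matrix.of ![a, b, c] with hA
  have hAA : A * Aᵀ = 1 := by
    ext i j
    rw [Matrix.mul_apply_eq_vecMul, Matrix.vecMul_transpose]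
    change A j ⬝ᵥ A i = _
    fin_cases i <;> fin_cases j
    exacts [h1, h4, h8, h3, h2, h9, h6, h7, h5]
  have hAA' : Aᵀ * A = 1 := mul_eq_one_comm.1 hAA
  have h10 : Aᵀ *ᵥ (A *ᵥ x) = x := by rw [Matrix.mulVec_mulVec, hAA', Matrix.one_mulVec]
  conv_lhs => rw [← h10]
  have h11 : A *ᵥ x = ![a ⬝ᵥ x, b ⬝ᵥ x, c ⬝ᵥ x] := by
    ext i
    fin_cases i <;> rfl
  rw [h11, Matrix.mulVec_transpose]
  ext i
  simp [Matrix.vecMul, dotProduct, Fin.sum_univ_three, hA]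

lemma IsFrame.eq_cross_or {a b w : Fin 3 → ℝ} (hab : IsFrame a b) (hw : w ⬝ᵥ w = 1)
    (haw : a ⬝ᵥ w = 0) (hbw : b ⬝ᵥ w = 0) : w = a ⨯₃ b ∨ w = -(a ⨯₃ b) := by
  have h := hab.expand w
  rw [haw, hbw, zero_smul, zero_smul, zero_add, zero_add] at h
  have h1 := hab.cross_unit
  have h2 : ((a ⨯₃ b) ⬝ᵥ w) ^ 2 = 1 := by
    rw [h, smul_dotProduct, dotProduct_smul, h1] at hw
    simpa [sq] using hw
  rcases (Commute.all _ _).sq_eq_sq_iff_eq_or_eq_neg.1 (h2.trans (one_pow 2).symm) with h3 | h3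
  · left; rw [h, h3, one_smul]
  · right; rw [h, h3, neg_one_smul]

lemma IsFrame.exists_cpt_eq {a b w x : Fin 3 → ℝ} (hab : IsFrame a b) (hw : w ⬝ᵥ w = 1)
    (haw : a ⬝ᵥ w = 0) (hbw : b ⬝ᵥ w = 0) (hx : x ⬝ᵥ x = 1) (hxw : x ⬝ᵥ w = 0) :
    ∃ θ, x = cpt a b θ := by
  have h := hab.expand x
  have h0 : (a ⨯₃ b) ⬝ᵥ x = 0 := by
    rw [dotProduct_comm]
    rcases hab.eq_cross_or hw haw hbw with rfl | rfl
    · exact hxw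
    · rwa [dotProduct_neg, neg_eq_zero] at hxw
  rw [h0, zero_smul, add_zero] at h
  have h1 : (a ⬝ᵥ x) ^ 2 + (b ⬝ᵥ x) ^ 2 = 1 := by
    obtain ⟨-, -, -⟩ := hab
    rw [h] at hx
    simp only [add_dotProduct, smul_dotProduct, smul_eq_mul] at hx
    rw [← h] at hx
    linear_combination hx
  obtain ⟨θ, -, h2, h3⟩ := exists_cos_sin_eq h1
  exact ⟨θ, by rw [cpt, ← h2, ← h3, ← h]⟩

lemma IsFrame.exists_rotAbout_cpt {a b w : Fin 3 → ℝ} (hab : IsFrame a b) (hw : w ⬝ᵥ w = 1)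
    (haw : a ⬝ᵥ w = 0) (hbw : b ⬝ᵥ w = 0) :
    ∃ σ : ℝ, (σ = 1 ∨ σ = -1) ∧ ∀ r θ, rotAbout w (σ * r) (cpt a b θ) = cpt a b (θ + r) := by
  have h1 : ∀ θ, (a ⨯₃ b) ⨯₃ cpt a b θ = Real.cos θ • b - Real.sin θ • a := by
    intro θ
    obtain ⟨h1, h2, h3⟩ := hab
    have h4 : b ⬝ᵥ a = 0 := by rw [dotProduct_comm, h3]
    rw [cross_cross_eq_smul_sub_smul]
    simp only [cpt, dotProduct_add, dotProduct_smul, smul_eq_mul, h1, h2, h3, h4]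
    simp
  rcases hab.eq_cross_or hw haw hbw with rfl | rfl
  · refine ⟨1, Or.inl rfl, fun r θ => ?_⟩
    rw [rotAbout, h1, one_mul]
    ext i
    simp [cpt, Real.cos_add, Real.sin_add]
    ring
  · refine ⟨-1, Or.inr rfl, fun r θ => ?_⟩
    rw [rotAbout, map_neg, LinearMap.neg_apply, h1]
    ext i
    simp [cpt, Real.cos_add, Real.sin_add]
    ring

lemma pairInv_eq_of_eq {ι : Type*} {F G : (Fin 3 → ℝ) → ι → ℝ} {x y : Fin 3 → ℝ}
    (h1 : G x = F y) (h2 : G (-x) = F (-y)) : pairInv G x = pairInv F y := by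
  ext q
  simp only [pairInv, h1, h2]

lemma UnitSph.exists_dot_gt_imp_mem {s : Set UnitSph} {w : UnitSph} (hw : w ∈ interior s) :
    ∃ c < 1, ∀ v : UnitSph, c < v.1 ⬝ᵥ w.1 → v ∈ s := by
  obtain ⟨ε, hε, h⟩ := Metric.mem_nhds_iff.1 (mem_interior_iff_mem_nhds.1 hw)
  refine ⟨1 - ε ^ 2 / 2, by nlinarith, fun v hv => h ?_⟩
  rw [Metric.mem_ball, Subtype.dist_eq, dist_pi_lt_iff hε]
  intro i
  rw [Real.dist_eq]
  refine abs_lt_of_sq_lt_sq ?_ hε.le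
  have h1 : (v.1 - w.1) ⬝ᵥ (v.1 - w.1) = 2 - 2 * (v.1 ⬝ᵥ w.1) := by
    rw [sub_dotProduct, dotProduct_sub, dotProduct_sub, v.2, w.2, dotProduct_comm w.1]
    ring
  have h2 : (v.1 i - w.1 i) ^ 2 ≤ (v.1 - w.1) ⬝ᵥ (v.1 - w.1) := by
    rw [sq]
    exact Finset.single_le_sum (f := fun i => (v.1 - w.1) i * (v.1 - w.1) i)
      (fun i _ => mul_self_nonneg _) (Finset.mem_univ i)
  linarith

section CircleCongruence

variable {ι : Type*} {F G : (Fin 3 → ℝ) → ι → ℝ}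

lemma isClosed_eq_rotAbout (hF : Continuous F) (hG : Continuous G) (r : ℝ) :
    IsClosed {w : UnitSph | ∀ x, x ⬝ᵥ x = 1 → x ⬝ᵥ w.1 = 0 → G x = F (rotAbout w.1 r x)} := by
  refine isClosed_forall_perp (w := fun w : UnitSph => w.1) continuous_subtype_val
    (fun w => w.2) (P := fun w x => G x = F (rotAbout w.1 r x)) ?_
  exact isClosed_eq (hG.comp continuous_snd) (hF.comp
    (continuous_rotAbout (continuous_subtype_val.comp continuous_fst) continuous_const
      continuous_snd))

lemma interior_eq_rotAbout_eq_empty (hF : Continuous F)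
    (hne : ∀ a b, IsFrame a b → ∃ θ, pairInv F (cpt a b θ) ≠ pairInv F (cpt a b 0))
    (hinv : ∀ x, x ⬝ᵥ x = 1 → pairInv G x = pairInv F x) {r : ℝ} (hr : Real.sin r ≠ 0) :
    interior {w : UnitSph | ∀ x, x ⬝ᵥ x = 1 → x ⬝ᵥ w.1 = 0 → G x = F (rotAbout w.1 r x)} = ∅ := by
  rw [Set.eq_empty_iff_forall_notMem]
  intro w0 hw0
  obtain ⟨c, hc, hmem⟩ := UnitSph.exists_dot_gt_imp_mem hw0
  obtain ⟨δ, hδ, hper⟩ := exists_pos_le_periods (continuous_pairInv hF) hne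
  obtain ⟨a, b, ha, hb, hab, haw, hbw⟩ := exists_orthonormal_frame w0.2
  have hfr : IsFrame a b := ⟨ha, hb, hab⟩
  obtain ⟨a, b, hfr, hw⟩ : ∃ a b, IsFrame a b ∧ w0.1 = a ⨯₃ b := by
    rcases hfr.eq_cross_or w0.2 haw hbw with h | h
    · exact ⟨a, b, hfr, h⟩
    · refine ⟨b, a, ⟨hb, ha, by rw [dotProduct_comm, hab]⟩, ?_⟩
      rw [h, cross_anticomm]
  have hsc := Real.sin_sq_add_cos_sq r
  have hs2 : 0 < Real.sin r ^ 2 := by positivity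
  have hsq : √(1 - Real.cos r ^ 2) = |Real.sin r| := by
    rw [← Real.sqrt_sq_eq_abs]
    congr 1
    linarith
  obtain ⟨α, hα, hα0, hαδ⟩ := exists_small_period (H := pairInv F) hfr (k := Real.cos r) (c := c)
    (by nlinarith [Real.neg_one_le_cos r]) (by nlinarith [Real.cos_le_one r]) hc (by
      intro x y hx hy hxy hlt
      rw [hsq, ← hw] at hlt
      have habs : 0 < |Real.sin r| := abs_pos.2 hr
      set w : Fin 3 → ℝ := |Real.sin r|⁻¹ • (x ⨯₃ y) with hwdef
      have hwu : w ⬝ᵥ w = 1 := by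
        rw [hwdef, smul_dotProduct, dotProduct_smul, cross_dot_cross, hx, hy,
          dotProduct_comm y x, hxy, smul_eq_mul, smul_eq_mul]
        field_simp
        rw [sq_abs]
        linarith
      have hwm := hmem ⟨w, hwu⟩ (by
        simp only [hwdef, smul_dotProduct, smul_eq_mul]
        field_simp
        linarith)
      have hxw : x ⬝ᵥ w = 0 := by rw [hwdef, dotProduct_smul, dot_self_cross, smul_zero]
      have hyw : y ⬝ᵥ w = 0 := by rw [hwdef, dotProduct_smul, dot_cross_self, smul_zero]
      have hneg : ∀ z, rotAbout w r (-z) = -rotAbout w r z := by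
        intro z
        simp only [rotAbout, map_neg, smul_neg, neg_add]
      have hcomb : ∀ u v, u ⬝ᵥ u = 1 → u ⬝ᵥ w = 0 → rotAbout w r u = v →
          pairInv F u = pairInv F v := by
        intro u v hu huw huv
        rw [← hinv u hu]
        refine pairInv_eq_of_eq ?_ ?_
        · rw [hwm u hu huw, huv]
        · rw [hwm (-u) (by simpa using hu) (by simpa using huw), hneg, huv]
      rcases hr.lt_or_gt with h | h
      · refine (hcomb y x hy hyw ?_).symm
        rw [rotAbout, hwdef, map_smul, LinearMap.smul_apply, cross_cross_eq_smul_sub_smul, hxy, hy,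
          abs_of_neg h]
        ext i
        simp
        field_simp
        ring
      · refine hcomb x y hx hxw ?_
        rw [rotAbout, hwdef, map_smul, LinearMap.smul_apply, cross_cross_eq_smul_sub_smul,
          dotProduct_comm y x, hxy, hx, abs_of_pos h]
        ext i
        simp
        field_simp
        ring) hδ
  exact absurd (hper a b hfr α hα hα0) (not_le.2 hαδ)

lemma pairInv_not_const (hF : Continuous F)
    (hns : ∀ a b, IsFrame a b → ∃ θ, F (cpt a b θ) ≠ F (-cpt a b θ)) (a b : Fin 3 → ℝ)
    (hab : IsFrame a b) : ∃ θ, pairInv F (cpt a b θ) ≠ pairInv F (cpt a b 0) := by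
  by_contra! h
  obtain ⟨θ, hθ⟩ := hns a b hab
  exact hθ (symmetric_of_pairInv_const hF h θ)

lemma UnitSph.forall_mem_or_forall_mem {A B : Set UnitSph} (hA : IsClosed A) (hB : IsClosed B)
    (hcov : ∀ w, w ∈ A ∨ w ∈ B) (hdis : ∀ w ∈ A, w ∉ B) : (∀ w, w ∈ A) ∨ (∀ w, w ∈ B) := by
  have hAB : Aᶜ = B := by
    ext w
    exact ⟨fun h => (hcov w).resolve_left h, fun h h' => hdis w h' h⟩
  have hclop : IsClopen A := ⟨hA, by rw [← isClosed_compl_iff, hAB]; exact hB⟩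
  rcases isClopen_iff.1 hclop with h | h
  · exact Or.inr fun w => (hcov w).resolve_left (by simp [h])
  · exact Or.inl fun w => by simp [h]

lemma exists_unit_dot_eq_zero (x : Fin 3 → ℝ) (hx : x ⬝ᵥ x = 1) : ∃ w : UnitSph, x ⬝ᵥ w.1 = 0 := by
  obtain ⟨a, b, ha, hb, hab, hax, hbx⟩ := exists_orthonormal_frame hx
  exact ⟨⟨a, ha⟩, by rw [dotProduct_comm, hax]⟩

lemma eq_or_eq_neg_of_forall_perp {P Q : (Fin 3 → ℝ) → Prop}
    (hP : IsClosed {w : UnitSph | ∀ x, x ⬝ᵥ x = 1 → x ⬝ᵥ w.1 = 0 → P x})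
    (hQ : IsClosed {w : UnitSph | ∀ x, x ⬝ᵥ x = 1 → x ⬝ᵥ w.1 = 0 → Q x})
    (hPQ : ∀ w : UnitSph, (∀ x, x ⬝ᵥ x = 1 → x ⬝ᵥ w.1 = 0 → P x) ∨
      (∀ x, x ⬝ᵥ x = 1 → x ⬝ᵥ w.1 = 0 → Q x))
    (hdis : ∀ w : UnitSph, ∃ x, x ⬝ᵥ x = 1 ∧ x ⬝ᵥ w.1 = 0 ∧ ¬ (P x ∧ Q x)) :
    (∀ x, x ⬝ᵥ x = 1 → P x) ∨ (∀ x, x ⬝ᵥ x = 1 → Q x) := by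
  rcases UnitSph.forall_mem_or_forall_mem hP hQ hPQ (fun w hw hw' => by
    obtain ⟨x, hx, hxw, h⟩ := hdis w
    exact h ⟨hw x hx hxw, hw' x hx hxw⟩) with h | h
  · left
    intro x hx
    obtain ⟨w, hw⟩ := exists_unit_dot_eq_zero x hx
    exact h w x hx hw
  · right
    intro x hx
    obtain ⟨w, hw⟩ := exists_unit_dot_eq_zero x hx
    exact h w x hx hw

/-- If `F` and `G` agree up to a rotation on every great circle and `F` is not even on any great
circle, then `G = F` or `G = F ∘ (-1)`. -/
lemma eq_or_eq_neg_of_circle_rotation (hF : Continuous F) (hG : Continuous G)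
    (hA : ∀ a b, IsFrame a b → ∃ α, ∀ θ, G (cpt a b θ) = F (cpt a b (θ + α)))
    (hns : ∀ a b, IsFrame a b → ∃ θ, F (cpt a b θ) ≠ F (-cpt a b θ)) :
    (∀ x, x ⬝ᵥ x = 1 → G x = F x) ∨ (∀ x, x ⬝ᵥ x = 1 → G x = F (-x)) := by
  have hcc : CircleCongr F G := by
    intro a b hab
    obtain ⟨α, hα⟩ := hA a b hab
    exact ⟨1, α, Or.inl rfl, fun θ => by rw [one_mul, hα]⟩
  have hinv : ∀ x, x ⬝ᵥ x = 1 → pairInv G x = pairInv F x := fun x hx => hcc.pairInv_eq hF hG hx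
  have hne := pairInv_not_const hF hns
  obtain ⟨N, hN, hper⟩ := exists_common_period (continuous_pairInv hF) hne
  have hN' : (N : ℝ) ≠ 0 := by exact_mod_cast hN.ne'
  set S : ℝ → Set UnitSph := fun r =>
    {w | ∀ x, x ⬝ᵥ x = 1 → x ⬝ᵥ w.1 = 0 → G x = F (rotAbout w.1 r x)} with hS
  have hSc : ∀ r, IsClosed (S r) := isClosed_eq_rotAbout hF hG
  have hcov : ⋃ m : ℤ, S (m * (2 * Real.pi) / N) = Set.univ := by
    rw [Set.eq_univ_iff_forall]
    intro w
    obtain ⟨a, b, ha, hb, hab, haw, hbw⟩ := exists_orthonormal_frame w.2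
    have hfr : IsFrame a b := ⟨ha, hb, hab⟩
    obtain ⟨α, hα⟩ := hA a b hfr
    obtain ⟨m, hm⟩ := hper a b hfr α (fun θ => by
      rw [← hinv _ (hfr.cpt_unit θ)]
      refine (pairInv_eq_of_eq (hα θ) ?_).symm
      rw [← cpt_add_pi, hα, ← cpt_add_pi]
      congr 2
      ring)
    obtain ⟨σ, hσ, hrot⟩ := hfr.exists_rotAbout_cpt w.2 haw hbw
    obtain ⟨n, hn⟩ : ∃ n : ℤ, (n : ℝ) * (2 * Real.pi) / N = σ * α := by
      have hα' : α = m * (2 * Real.pi) / N := by field_simp; linarith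
      rcases hσ with rfl | rfl
      · exact ⟨m, by rw [hα', one_mul]⟩
      · exact ⟨-m, by rw [hα']; push_cast; ring⟩
    refine Set.mem_iUnion.2 ⟨n, ?_⟩
    rw [hn]
    intro x hx hxw
    obtain ⟨θ, rfl⟩ := hfr.exists_cpt_eq w.2 haw hbw hx hxw
    rw [hrot, hα]
  have hdense := dense_iUnion_interior_of_closed (fun m : ℤ => hSc (m * (2 * Real.pi) / N)) hcov
  have hneg : ∀ (w : UnitSph) x, rotAbout w.1 Real.pi x = -x := by
    intro w x
    simp [rotAbout]
  have hzero : ∀ (w : UnitSph) x, rotAbout w.1 0 x = x := by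
    intro w x
    simp [rotAbout]
  have hsub : ⋃ m : ℤ, interior (S (m * (2 * Real.pi) / N)) ⊆ S 0 ∪ S Real.pi := by
    refine Set.iUnion_subset fun m => ?_
    by_cases hs : Real.sin (m * (2 * Real.pi) / N) = 0
    · refine interior_subset.trans fun w hw => ?_
      have hcos := Real.sin_sq_add_cos_sq (m * (2 * Real.pi) / N)
      rw [hs, zero_pow two_ne_zero, zero_add] at hcos
      rcases sq_eq_one_iff.1 hcos with h | h
      · left
        intro x hx hxw
        rw [hw x hx hxw, hzero, rotAbout, hs, h, one_smul, zero_smul, add_zero]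
      · right
        intro x hx hxw
        rw [hw x hx hxw, hneg, rotAbout, hs, h, neg_one_smul, zero_smul, add_zero]
    · rw [interior_eq_rotAbout_eq_empty hF hne hinv hs]
      exact Set.empty_subset _
  have hall : S 0 ∪ S Real.pi = Set.univ :=
    (((hSc 0).union (hSc Real.pi)).closure_eq ▸ (hdense.mono hsub).closure_eq)
  refine eq_or_eq_neg_of_forall_perp (P := fun x => G x = F x) (Q := fun x => G x = F (-x))
    ?_ ?_ ?_ ?_
  · simpa only [hS, hzero] using hSc 0
  · simpa only [hS, hneg] using hSc Real.pi
  · intro w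
    simpa only [hS, hneg, hzero, Set.mem_union, Set.mem_ofPred_eq] using
      (Set.eq_univ_iff_forall.1 hall w)
  · intro w
    obtain ⟨a, b, ha, hb, hab, haw, hbw⟩ := exists_orthonormal_frame w.2
    have hfr : IsFrame a b := ⟨ha, hb, hab⟩
    obtain ⟨θ, hθ⟩ := hns a b hfr
    refine ⟨_, hfr.cpt_unit θ, ?_, fun h => hθ (h.1.symm.trans h.2)⟩
    simp [cpt, haw, hbw]

lemma not_circle_reflection (hF : Continuous F) (hG : Continuous G)
    (hB : ∀ a b, IsFrame a b → ∃ β, ∀ θ, G (cpt a b θ) = F (cpt a b (β - θ)))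
    (hns : ∀ a b, IsFrame a b → ∃ θ, F (cpt a b θ) ≠ F (-cpt a b θ)) : False := by
  have hcc : CircleCongr F G := by
    intro a b hab
    obtain ⟨β, hβ⟩ := hB a b hab
    refine ⟨-1, β, Or.inr rfl, fun θ => ?_⟩
    rw [hβ]
    congr 2
    ring
  refine not_forall_exists_reflection (continuous_pairInv hF) (pairInv_not_const hF hns) ?_
  intro a b hab
  obtain ⟨β, hβ⟩ := hB a b hab
  refine ⟨β, fun θ => ?_⟩
  rw [← hcc.pairInv_eq hF hG (hab.cpt_unit θ)]
  refine (pairInv_eq_of_eq (hβ θ) ?_).symm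
  rw [← cpt_add_pi, hβ, ← cpt_add_pi, ← cpt_periodic a b]
  congr 2
  ring

end CircleCongruence

/-- Reflection of `ℝ³` in the line spanned by the unit vector `u`. -/
def reflLine (u x : Fin 3 → ℝ) : Fin 3 → ℝ := (2 * (x ⬝ᵥ u)) • u - x

lemma IsFrame.reflLine_cpt {a b : Fin 3 → ℝ} (h : IsFrame a b) (ψ θ : ℝ) :
    reflLine (cpt a b ψ) (cpt a b θ) = cpt a b (2 * ψ - θ) := by
  have h4 : b ⬝ᵥ a = 0 := by rw [dotProduct_comm, h.2.2]
  have h5 : cpt a b θ ⬝ᵥ cpt a b ψ = Real.cos θ * Real.cos ψ + Real.sin θ * Real.sin ψ := by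
    simp only [cpt, add_dotProduct, dotProduct_add, smul_dotProduct, dotProduct_smul,
      smul_eq_mul, h.1, h.2.1, h.2.2, h4]
    ring
  rw [reflLine, h5]
  have h6 := Real.sin_sq_add_cos_sq ψ
  ext i
  simp only [cpt, Pi.add_apply, Pi.sub_apply, Pi.smul_apply, smul_eq_mul, Real.cos_sub,
    Real.sin_sub, Real.cos_two_mul, Real.sin_two_mul]
  linear_combination (2 * Real.sin θ * b i) * h6

/-- If on a dense set of great circles `G` differs from `F` by a rotation, or by a reflection
combined with a sign change of the parameter, and `F` has no symmetries of these types on any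
great circle, then `G = F` or `G = F ∘ (-1)`. -/
lemma eq_or_eq_neg_of_dense {F G : (Fin 3 → ℝ) → ℝ → ℝ}
    (hF : Continuous F) (hG : Continuous G)
    (hF' : Continuous fun x s => F x (-s))
    (D : Set UnitSph) (hD : Dense D)
    (h : ∀ w ∈ D,
      (∃ r ∈ Set.Icc 0 (2 * Real.pi), ∀ x, x ⬝ᵥ x = 1 → x ⬝ᵥ w.1 = 0 →
        G x = F (rotAbout w.1 r x)) ∨
      (∃ u : UnitSph, u.1 ⬝ᵥ w.1 = 0 ∧ ∀ x, x ⬝ᵥ x = 1 → x ⬝ᵥ w.1 = 0 →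
        G x = fun s => F (reflLine u.1 x) (-s)))
    (hA : ∀ w : UnitSph, ∃ x, x ⬝ᵥ x = 1 ∧ x ⬝ᵥ w.1 = 0 ∧ F x ≠ F (-x))
    (hB : ∀ w u : UnitSph, u.1 ⬝ᵥ w.1 = 0 → ∃ x, x ⬝ᵥ x = 1 ∧ x ⬝ᵥ w.1 = 0 ∧
      F x ≠ fun s => F (reflLine u.1 x) (-s)) :
    (∀ x, x ⬝ᵥ x = 1 → G x = F x) ∨ (∀ x, x ⬝ᵥ x = 1 → G x = F (-x)) := by
  set A : Set UnitSph := {w | ∃ r ∈ Set.Icc 0 (2 * Real.pi), ∀ x, x ⬝ᵥ x = 1 → x ⬝ᵥ w.1 = 0 →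
        G x = F (rotAbout w.1 r x)} with hAdef
  set B : Set UnitSph := {w | ∃ u : UnitSph, u.1 ⬝ᵥ w.1 = 0 ∧ ∀ x, x ⬝ᵥ x = 1 → x ⬝ᵥ w.1 = 0 →
        G x = fun s => F (reflLine u.1 x) (-s)} with hBdef
  have hAc : IsClosed A := by
    have h1 := isClosed_forall_perp (Q := UnitSph × Set.Icc 0 (2 * Real.pi))
      (w := fun q => q.1.1) (by fun_prop) (fun q => q.1.2)
      (P := fun q x => G x = F (rotAbout q.1.1 q.2.1 x))
      (isClosed_eq (hG.comp continuous_snd)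
        (hF.comp (continuous_rotAbout (by fun_prop) (by fun_prop) (by fun_prop))))
    convert isClosedMap_fst_of_compactSpace _ h1 using 1
    ext w
    simp [hAdef]
  have hBc : IsClosed B := by
    have h1 := isClosed_forall_perp (Q := UnitSph × UnitSph)
      (w := fun q => q.1.1) (by fun_prop) (fun q => q.1.2)
      (P := fun q x => G x = fun s => F (reflLine q.2.1 x) (-s))
      (isClosed_eq (hG.comp continuous_snd) (hF'.comp (by
        unfold reflLine
        have : Continuous fun q : (UnitSph × UnitSph) × (Fin 3 → ℝ) => q.2 ⬝ᵥ q.1.2.1 :=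
          Continuous.dotProduct (by fun_prop) (by fun_prop)
        fun_prop)))
    have h2 : IsClosed {q : UnitSph × UnitSph | q.2.1 ⬝ᵥ q.1.1 = 0} :=
      isClosed_eq (Continuous.dotProduct (by fun_prop) (by fun_prop)) continuous_const
    convert isClosedMap_fst_of_compactSpace _ (h2.inter h1) using 1
    ext w
    simp [hBdef]
  have hcov : ∀ w, w ∈ A ∨ w ∈ B := by
    have h1 : A ∪ B = Set.univ :=
      (hAc.union hBc).closure_eq ▸ (hD.mono fun w hw => h w hw).closure_eq
    exact fun w => Set.eq_univ_iff_forall.1 h1 w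
  have hdis : ∀ w ∈ A, w ∉ B := by
    rintro w ⟨r, -, hr⟩ ⟨u, huw, hu⟩
    obtain ⟨a, b, ha, hb, hab, haw, hbw⟩ := exists_orthonormal_frame w.2
    have hfr : IsFrame a b := ⟨ha, hb, hab⟩
    have hcw : ∀ θ, cpt a b θ ⬝ᵥ w.1 = 0 := fun θ => by simp [cpt, haw, hbw]
    obtain ⟨σ, hσ, hrot⟩ := hfr.exists_rotAbout_cpt w.2 haw hbw
    obtain ⟨ψ, hψ⟩ := hfr.exists_cpt_eq w.2 haw hbw u.2 huw
    have hσr : r = σ * (σ * r) := by rcases hσ with rfl | rfl <;> ring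
    obtain ⟨x, hx, hxw, hne⟩ := hB w ⟨cpt a b (ψ + σ * r / 2), hfr.cpt_unit _⟩ (hcw _)
    obtain ⟨θ, rfl⟩ := hfr.exists_cpt_eq w.2 haw hbw hx hxw
    refine hne ?_
    have h1 := hr _ (hfr.cpt_unit (θ - σ * r)) (hcw _)
    have h2 := hu _ (hfr.cpt_unit (θ - σ * r)) (hcw _)
    have h3 : rotAbout w.1 r (cpt a b (θ - σ * r)) = cpt a b θ := by
      have := hrot (σ * r) (θ - σ * r)
      rwa [← hσr, sub_add_cancel] at this
    rw [h3, h2, hψ, hfr.reflLine_cpt] at h1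
    rw [← h1, hfr.reflLine_cpt]
    ext s
    congr 2
    ring
  rcases UnitSph.forall_mem_or_forall_mem hAc hBc hcov hdis with hall | hall
  · refine eq_or_eq_neg_of_circle_rotation hF hG ?_ ?_
    · intro a b hfr
      obtain ⟨r, -, hr⟩ := hall ⟨a ⨯₃ b, hfr.cross_unit⟩
      have haw : a ⬝ᵥ (a ⨯₃ b) = 0 := dot_self_cross a b
      have hbw : b ⬝ᵥ (a ⨯₃ b) = 0 := dot_cross_self a b
      obtain ⟨σ, hσ, hrot⟩ := hfr.exists_rotAbout_cpt hfr.cross_unit haw hbw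
      have hσr : r = σ * (σ * r) := by rcases hσ with rfl | rfl <;> ring
      refine ⟨σ * r, fun θ => ?_⟩
      rw [hr _ (hfr.cpt_unit θ) (by simp [cpt, haw, hbw]), ← hrot, ← hσr]
    · intro a b hfr
      obtain ⟨x, hx, hxw, hne⟩ := hA ⟨a ⨯₃ b, hfr.cross_unit⟩
      obtain ⟨θ, rfl⟩ := hfr.exists_cpt_eq hfr.cross_unit (dot_self_cross a b)
        (dot_cross_self a b) hx hxw
      exact ⟨θ, hne⟩
  · refine (not_circle_reflection hF' hG ?_ ?_).elim
    · intro a b hfr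
      have haw : a ⬝ᵥ (a ⨯₃ b) = 0 := dot_self_cross a b
      have hbw : b ⬝ᵥ (a ⨯₃ b) = 0 := dot_cross_self a b
      obtain ⟨u, huw, hu⟩ := hall ⟨a ⨯₃ b, hfr.cross_unit⟩
      obtain ⟨ψ, hψ⟩ := hfr.exists_cpt_eq hfr.cross_unit haw hbw u.2 huw
      refine ⟨2 * ψ, fun θ => ?_⟩
      rw [hu _ (hfr.cpt_unit θ) (by simp [cpt, haw, hbw]), hψ, hfr.reflLine_cpt]
    · intro a b hfr
      obtain ⟨x, hx, hxw, hne⟩ := hA ⟨a ⨯₃ b, hfr.cross_unit⟩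
      obtain ⟨θ, rfl⟩ := hfr.exists_cpt_eq hfr.cross_unit (dot_self_cross a b)
        (dot_cross_self a b) hx hxw
      refine ⟨θ, fun h => hne ?_⟩
      ext s
      simpa using congrFun h (-s)

section SupportFunction

variable {K L : Set E4}

lemma bddAbove_inner_image (hK : IsCompact K) (x : E4) : BddAbove ((fun y => ⟪x, y⟫) '' K) :=
  (hK.image (by fun_prop)).bddAbove

lemma le_suppFn (hK : IsCompact K) (x : E4) {y : E4} (hy : y ∈ K) : ⟪x, y⟫ ≤ suppFn K x :=
  le_csSup (bddAbove_inner_image hK x) ⟨y, hy, rfl⟩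

lemma exists_suppFn_eq (hK : IsCompact K) (hne : K.Nonempty) (x : E4) :
    ∃ y ∈ K, ⟪x, y⟫ = suppFn K x :=
  (hK.image (show Continuous fun y => ⟪x, y⟫ by fun_prop)).sSup_mem (hne.image _)

lemma suppFn_image (hK : IsCompact K) (hne : K.Nonempty) {f : E4 → E4} {x x' : E4} {c : ℝ}
    (h : ∀ y ∈ K, ⟪x, f y⟫ = ⟪x', y⟫ + c) : suppFn (f '' K) x = suppFn K x' + c := by
  have h1 : (fun y => ⟪x, y⟫) '' (f '' K) = (fun t => t + c) '' ((fun y => ⟪x', y⟫) '' K) := by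
    rw [Set.image_image, Set.image_image]
    exact Set.image_congr h
  rw [suppFn, h1]
  refine IsLUB.csSup_eq ?_ ((hne.image _).image _)
  exact (OrderIso.addRight c).isLUB_image'.2
    (isLUB_csSup (hne.image _) (bddAbove_inner_image hK x'))

open scoped Pointwise in
lemma suppFn_smul (K : Set E4) {c : ℝ} (hc : 0 ≤ c) (x : E4) :
    suppFn K (c • x) = c * suppFn K x := by
  have : (fun y => ⟪c • x, y⟫) '' K = c • ((fun y => ⟪x, y⟫) '' K) := by
    ext t
    simp [Set.mem_smul_set, real_inner_smul_left]
  rw [suppFn, this, Real.sSup_smul_of_nonneg hc, smul_eq_mul, suppFn]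

lemma continuous_suppFn (hK : IsCompact K) : Continuous (suppFn K) :=
  hK.continuous_sSup (f := fun x y => ⟪x, y⟫) (by
    simp only [Function.HasUncurry.uncurry, id]
    fun_prop)

lemma subset_of_suppFn_le (hK : IsCompact K) (hL : IsCompact L) (hLc : Convex ℝ L)
    (hLne : L.Nonempty) (h : ∀ x, suppFn K x ≤ suppFn L x) : K ⊆ L := by
  intro y hy
  by_contra hyL
  obtain ⟨f, u, hfL, hfy⟩ := geometric_hahn_banach_closed_point hLc hL.isClosed hyL
  set x := (InnerProductSpace.toDual ℝ E4).symm f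
  have hx : ∀ z, ⟪x, z⟫ = f z := fun z => InnerProductSpace.toDual_symm_apply
  obtain ⟨z, hz, hz'⟩ := exists_suppFn_eq hL hLne x
  have h1 := le_suppFn hK x hy
  have h2 := h x
  have h3 := hfL z hz
  rw [hx] at h1 hz'
  linarith

lemma eq_of_suppFn_eq (hK : IsCompact K) (hL : IsCompact L) (hKc : Convex ℝ K) (hLc : Convex ℝ L)
    (hKne : K.Nonempty) (hLne : L.Nonempty) (h : ∀ x, suppFn K x = suppFn L x) : K = L :=
  (subset_of_suppFn_le hK hL hLc hLne fun x => (h x).le).antisymm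
    (subset_of_suppFn_le hL hK hKc hKne fun x => (h x).ge)

lemma inner_projHyp {w x : E4} (h : ⟪x, w⟫ = 0) (y : E4) : ⟪x, projHyp w y⟫ = ⟪x, y⟫ := by
  rw [projHyp, inner_sub_right, inner_smul_right, h, mul_zero, sub_zero]

lemma continuous_projHyp (w : E4) : Continuous (projHyp w) := by
  unfold projHyp
  fun_prop

lemma suppFn_projHyp (hK : IsCompact K) (hne : K.Nonempty) {w x : E4} (h : ⟪x, w⟫ = 0) :
    suppFn (projHyp w '' K) x = suppFn K x := by
  rw [suppFn_image hK hne (x' := x) (c := 0) fun y _ => by rw [inner_projHyp h, add_zero],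
    add_zero]

lemma inner_symm_apply (φ : E4 ≃ₗᵢ[ℝ] E4) (x y : E4) : ⟪φ.symm x, y⟫ = ⟪x, φ y⟫ := by
  rw [← φ.inner_map_map, φ.apply_symm_apply]

lemma inner_symm_of_fixed {φ : E4 ≃ₗᵢ[ℝ] E4} {w x : E4} (hφ : φ w = w) (hx : ⟪x, w⟫ = 0) :
    ⟪φ.symm x, w⟫ = 0 := by
  rw [inner_symm_apply, hφ, hx]

lemma suppFn_of_image_eq (hK : IsCompact K) (hL : IsCompact L) (hKne : K.Nonempty)
    (hLne : L.Nonempty) {w a : E4} {φ : E4 ≃ₗᵢ[ℝ] E4} (hφ : φ w = w)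
    (h : φ '' (projHyp w '' K) = (fun x => x + a) '' (projHyp w '' L)) {x : E4}
    (hx : ⟪x, w⟫ = 0) : suppFn K (φ.symm x) = suppFn L x + ⟪x, a⟫ := by
  have h1 : suppFn (φ '' (projHyp w '' K)) x = suppFn (projHyp w '' K) (φ.symm x) + 0 :=
    suppFn_image (hK.image (continuous_projHyp w)) (hKne.image _) fun y _ => by
      rw [inner_symm_apply, add_zero]
  have h2 : suppFn ((fun x => x + a) '' (projHyp w '' L)) x =
      suppFn (projHyp w '' L) x + ⟪x, a⟫ :=
    suppFn_image (hL.image (continuous_projHyp w)) (hLne.image _) fun y _ => inner_add_right _ _ _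
  rw [suppFn_projHyp hK hKne (inner_symm_of_fixed hφ hx)] at h1
  rw [suppFn_projHyp hL hLne hx] at h2
  rw [← h2, ← h, h1, add_zero]

lemma projHyp_add_smul (w : E4) (x : E4) : x = projHyp w x + ⟪x, w⟫ • w := by
  rw [projHyp, sub_add_cancel]

lemma inner_projHyp_self {w : E4} (hw : w ∈ sph) (x : E4) : ⟪projHyp w x, w⟫ = 0 := by
  have : ⟪w, w⟫ = 1 := by
    rw [real_inner_self_eq_norm_sq, mem_sphere_zero_iff_norm.1 hw, one_pow]
  rw [projHyp, inner_sub_left, real_inner_smul_left, this, mul_one, sub_self]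

lemma convex_projHyp_image (hK : Convex ℝ K) (w : E4) : Convex ℝ (projHyp w '' K) := by
  rintro _ ⟨x, hx, rfl⟩ _ ⟨y, hy, rfl⟩ s t hs ht hst
  refine ⟨s • x + t • y, hK hx hy hs ht hst, ?_⟩
  simp only [projHyp, inner_add_left, real_inner_smul_left]
  module

lemma image_eq_of_suppFn (hK : IsCompact K) (hKc : Convex ℝ K) (hKne : K.Nonempty) {w : E4}
    (hw : w ∈ sph) {φ : E4 ≃ₗᵢ[ℝ] E4} (hφ : φ w = w) {c : E4}
    (h : ∀ x, ⟪x, w⟫ = 0 → suppFn K (φ.symm x) = suppFn K x + ⟪x, c⟫) :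
    ∃ a, ⟪a, w⟫ = 0 ∧ φ '' (projHyp w '' K) = (fun x => x + a) '' (projHyp w '' K) := by
  refine ⟨projHyp w c, inner_projHyp_self hw c, ?_⟩
  have hP := hK.image (continuous_projHyp w)
  have hPc := convex_projHyp_image hKc w
  have hPne := hKne.image (projHyp w)
  refine eq_of_suppFn_eq (hP.image φ.continuous) (hP.image (by fun_prop))
    (hPc.linear_image (φ.toLinearEquiv : E4 →ₗ[ℝ] E4)) ?_ (hPne.image _) (hPne.image _) ?_
  · simpa only [add_comm] using hPc.translate (projHyp w c)
  intro x
  set x' := projHyp w x with hx'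
  have hxw : ⟪x', w⟫ = 0 := inner_projHyp_self hw x
  have hdec : ∀ y, ⟪y, w⟫ = 0 → ⟪x, y⟫ = ⟪x', y⟫ := by
    intro y hy
    rw [real_inner_comm, ← inner_projHyp hy, real_inner_comm]
  rw [Set.image_image, Set.image_image,
    suppFn_image hK hKne (x' := φ.symm x') (c := 0) fun y _ => ?_,
    suppFn_image hK hKne (x' := x') (c := ⟪x', c⟫) fun y _ => ?_, add_zero, h x' hxw]
  · rw [hdec _ (by rw [inner_add_left, inner_projHyp_self hw, inner_projHyp_self hw, add_zero]),
      inner_add_right, inner_projHyp hxw, inner_projHyp hxw]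
  · have h1 : ⟪φ (projHyp w y), w⟫ = 0 := by
      have := φ.inner_map_map (projHyp w y) w
      rwa [hφ, inner_projHyp_self hw] at this
    rw [hdec _ h1, add_zero,
      ← inner_symm_apply, inner_projHyp (inner_symm_of_fixed hφ hxw)]

end SupportFunction

section Diameters

variable {K L : Set E4}

lemma continuous_widthFn (hK : IsCompact K) : Continuous (widthFn K) := by
  have := continuous_suppFn hK
  unfold widthFn
  fun_prop

lemma widthFn_neg (K : Set E4) (x : E4) : widthFn K (-x) = widthFn K x := by
  rw [widthFn, widthFn, neg_neg, add_comm]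

lemma widthFn_le_maxWidth (hK : IsCompact K) {x : E4} (hx : x ∈ sph) :
    widthFn K x ≤ maxWidth K :=
  le_csSup ((isCompact_sphere (0 : E4) 1).image (continuous_widthFn hK)).bddAbove ⟨x, hx, rfl⟩

lemma inner_self_of_mem_sph {x : E4} (hx : x ∈ sph) : ⟪x, x⟫ = 1 := by
  rw [real_inner_self_eq_norm_sq, mem_sphere_zero_iff_norm.1 hx, one_pow]

lemma map_mem_sph (φ : E4 ≃ₗᵢ[ℝ] E4) {x : E4} (hx : x ∈ sph) : φ x ∈ sph := by
  rw [sph, mem_sphere_zero_iff_norm, φ.norm_map]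
  exact mem_sphere_zero_iff_norm.1 hx

/-- The point `c` is the midpoint of the unique chord of `K` joining the two support hyperplanes
orthogonal to `d`. -/
def IsCenter (K : Set E4) (d c : E4) : Prop :=
  ∃ p ∈ K, ∃ q ∈ K, c = (1 / 2 : ℝ) • (p + q) ∧ ⟪d, p⟫ = suppFn K d ∧ ⟪-d, q⟫ = suppFn K (-d) ∧
    (∀ y ∈ K, ⟪d, y⟫ = suppFn K d → y = p) ∧ (∀ y ∈ K, ⟪-d, y⟫ = suppFn K (-d) → y = q)

lemma exists_isCenter (hK : IsCompact K) (hne : K.Nonempty) {d : E4} (hd : d ∈ DiamDirs K) :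
    ∃ c, IsCenter K d c := by
  have hchord : ∀ p ∈ K, ∀ q ∈ K, ⟪d, p⟫ = suppFn K d → ⟪-d, q⟫ = suppFn K (-d) →
      p - q = maxWidth K • d := by
    intro p hp q hq h1 h2
    have hM : ⟪d, p - q⟫ = maxWidth K := by
      rw [← hd.2, widthFn, ← h1, ← h2, inner_neg_left, inner_sub_right]
      ring
    have hle : ‖p - q‖ ≤ maxWidth K := by
      rcases eq_or_ne (p - q) 0 with h0 | h0
      · rw [← hM, h0]
        simp
      · have hn : 0 < ‖p - q‖ := norm_pos_iff.2 h0
        set θ := ‖p - q‖⁻¹ • (p - q)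
        have hθ : θ ∈ sph := by
          rw [sph, mem_sphere_zero_iff_norm, norm_smul, norm_inv, norm_norm,
            inv_mul_cancel₀ hn.ne']
        have h3 : ⟪θ, p - q⟫ = ‖p - q‖ := by
          rw [real_inner_smul_left, real_inner_self_eq_norm_sq]
          field_simp
        have h4 := le_suppFn hK θ hp
        have h5 := le_suppFn hK (-θ) hq
        have h6 := widthFn_le_maxWidth hK hθ
        rw [inner_sub_right] at h3
        rw [inner_neg_left] at h5
        rw [widthFn] at h6
        linarith
    have hd1 := inner_self_of_mem_sph hd.1
    have hz : ‖p - q - maxWidth K • d‖ ^ 2 ≤ 0 := by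
      rw [norm_sub_sq_real, norm_smul, real_inner_smul_right, real_inner_comm, hM,
        mem_sphere_zero_iff_norm.1 hd.1, mul_one, Real.norm_eq_abs, sq_abs]
      nlinarith [norm_nonneg (p - q)]
    have : ‖p - q - maxWidth K • d‖ = 0 := by
      have := sq_nonneg ‖p - q - maxWidth K • d‖
      exact pow_eq_zero_iff two_ne_zero |>.1 (le_antisymm hz this)
    exact sub_eq_zero.1 (norm_eq_zero.1 this)
  obtain ⟨p, hp, hp'⟩ := exists_suppFn_eq hK hne d
  obtain ⟨q, hq, hq'⟩ := exists_suppFn_eq hK hne (-d)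
  refine ⟨_, p, hp, q, hq, rfl, hp', hq', fun y hy hy' => ?_, fun y hy hy' => ?_⟩
  · have h1 := hchord y hy q hq hy' hq'
    rw [← hchord p hp q hq hp' hq'] at h1
    exact sub_left_injective h1
  · have h1 := hchord p hp y hy hp' hy'
    rw [← hchord p hp q hq hp' hq'] at h1
    exact sub_right_injective h1

lemma IsCenter.neg {d c : E4} (h : IsCenter K d c) : IsCenter K (-d) c := by
  obtain ⟨p, hp, q, hq, hc, h1, h2, h3, h4⟩ := h
  refine ⟨q, hq, p, hp, by rw [hc, add_comm], h2, ?_, h4, ?_⟩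
  · rwa [neg_neg]
  · rwa [neg_neg]

/-- The support function of the translate `K - c`. -/
def centeredSupp (K : Set E4) (c x : E4) : ℝ := suppFn K x - ⟪x, c⟫

lemma continuous_centeredSupp (hK : IsCompact K) (c : E4) : Continuous (centeredSupp K c) := by
  have := continuous_suppFn hK
  unfold centeredSupp
  fun_prop

lemma centeredSupp_smul (K : Set E4) (c : E4) {t : ℝ} (ht : 0 ≤ t) (x : E4) :
    centeredSupp K c (t • x) = t * centeredSupp K c x := by
  rw [centeredSupp, centeredSupp, suppFn_smul K ht, real_inner_smul_left]
  ring

lemma IsCenter.centeredSupp_eq {d c : E4} (h : IsCenter K d c) :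
    centeredSupp K c d = widthFn K d / 2 := by
  obtain ⟨p, hp, q, hq, hc, h1, h2, -, -⟩ := h
  rw [centeredSupp, hc, widthFn, ← h1, ← h2, inner_smul_right, inner_add_right, inner_neg_left]
  ring

/-- A congruence of two projections maps centers to centers, so that no translation is left
after centering. -/
lemma centeredSupp_symm_eq (hK : IsCompact K) (hL : IsCompact L) (hKne : K.Nonempty)
    (hLne : L.Nonempty) {w a d c c' : E4} {φ : E4 ≃ₗᵢ[ℝ] E4} (hφ : φ w = w) (hdw : ⟪d, w⟫ = 0)
    (h : φ '' (projHyp w '' K) = (fun x => x + a) '' (projHyp w '' L)) (hc : IsCenter K d c)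
    (hc' : IsCenter L (φ d) c') {x : E4} (hx : ⟪x, w⟫ = 0) :
    centeredSupp K c (φ.symm x) = centeredSupp L c' x := by
  have hφdw : ∀ e, ⟪e, w⟫ = 0 → ⟪φ e, w⟫ = 0 := by
    intro e he
    have := φ.inner_map_map e w
    rwa [hφ, he] at this
  have hsupp := fun {x : E4} (hx : ⟪x, w⟫ = 0) => suppFn_of_image_eq hK hL hKne hLne hφ h hx
  have hend : ∀ e, ⟪e, w⟫ = 0 → ∀ p ∈ K, ⟪e, p⟫ = suppFn K e → ∃ y ∈ L,
      ⟪φ e, y⟫ = suppFn L (φ e) ∧ φ (projHyp w p) = projHyp w y + a := by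
    intro e he p hp hep
    have hmem : φ (projHyp w p) ∈ φ '' (projHyp w '' K) := ⟨_, ⟨p, hp, rfl⟩, rfl⟩
    rw [h] at hmem
    obtain ⟨_, ⟨y, hy, rfl⟩, hya⟩ := hmem
    refine ⟨y, hy, ?_, hya.symm⟩
    have h1 := hsupp (hφdw e he)
    rw [φ.symm_apply_apply, ← hep, ← inner_projHyp he, ← φ.inner_map_map, ← hya,
      inner_add_right, inner_projHyp (hφdw e he)] at h1
    linarith
  obtain ⟨p, hp, q, hq, rfl, hp1, hq1, -, -⟩ := hc
  obtain ⟨p', -, q', -, rfl, -, -, hp2, hq2⟩ := hc'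
  obtain ⟨y, hy, hy1, hy2⟩ := hend d hdw p hp hp1
  obtain ⟨z, hz, hz1, hz2⟩ := hend (-d) (by rw [inner_neg_left, hdw, neg_zero]) q hq hq1
  rw [map_neg] at hz1
  obtain rfl := hp2 y hy hy1
  obtain rfl := hq2 z hz hz1
  have e1 : ⟪φ.symm x, p⟫ = ⟪x, y⟫ + ⟪x, a⟫ := by
    rw [← inner_projHyp (inner_symm_of_fixed hφ hx), inner_symm_apply, hy2, inner_add_right,
      inner_projHyp hx]
  have e2 : ⟪φ.symm x, q⟫ = ⟪x, z⟫ + ⟪x, a⟫ := by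
    rw [← inner_projHyp (inner_symm_of_fixed hφ hx), inner_symm_apply, hz2, inner_add_right,
      inner_projHyp hx]
  rw [centeredSupp, centeredSupp, hsupp hx, inner_smul_right, inner_smul_right, inner_add_right,
    inner_add_right, e1, e2]
  ring

lemma exists_mem_S2_inner_eq_zero (ζ x : E4) : ∃ w ∈ S2 ζ, ⟪x, w⟫ = 0 := by
  have hlt : Module.finrank ℝ (Submodule.span ℝ {ζ, x}) < Module.finrank ℝ E4 := by
    classical
    have h := (finrank_span_finset_le_card (R := ℝ) ({ζ, x} : Finset E4)).trans Finset.card_le_two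
    rw [Finset.coe_insert, Finset.coe_singleton, Set.finrank] at h
    rw [finrank_euclideanSpace_fin]
    exact h.trans_lt (by norm_num)
  have hbot : (Submodule.span ℝ {ζ, x})ᗮ ≠ ⊥ := by
    intro h
    rw [Submodule.orthogonal_eq_bot_iff] at h
    rw [h, finrank_top] at hlt
    exact lt_irrefl _ hlt
  obtain ⟨v, hv, hv0⟩ := Submodule.exists_mem_ne_zero_of_ne_bot hbot
  have hn : ‖v‖ ≠ 0 := norm_ne_zero_iff.2 hv0
  have h1 : ⟪ζ, v⟫ = 0 := hv ζ (Submodule.subset_span (by simp))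
  have h2 : ⟪x, v⟫ = 0 := hv x (Submodule.subset_span (by simp))
  refine ⟨‖v‖⁻¹ • v, ⟨?_, ?_⟩, ?_⟩
  · rw [sph, mem_sphere_zero_iff_norm, norm_smul, norm_inv, norm_norm, inv_mul_cancel₀ hn]
  · rw [real_inner_smul_left, real_inner_comm, h1, mul_zero]
  · rw [real_inner_smul_right, h2, mul_zero]

lemma widthFn_symm_eq (hK : IsCompact K) (hL : IsCompact L) (hKne : K.Nonempty)
    (hLne : L.Nonempty) {w a : E4} {φ : E4 ≃ₗᵢ[ℝ] E4} (hφ : φ w = w)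
    (h : φ '' (projHyp w '' K) = (fun x => x + a) '' (projHyp w '' L)) {x : E4}
    (hx : ⟪x, w⟫ = 0) : widthFn K (φ.symm x) = widthFn L x := by
  have hx' : ⟪-x, w⟫ = 0 := by rw [inner_neg_left, hx, neg_zero]
  rw [widthFn, widthFn, ← map_neg, suppFn_of_image_eq hK hL hKne hLne hφ h hx,
    suppFn_of_image_eq hK hL hKne hLne hφ h hx', inner_neg_left]
  ring

lemma map_mem_diamDirs (hK : IsCompact K) (hL : IsCompact L) (hKne : K.Nonempty)
    (hLne : L.Nonempty) {ζ : E4} (hζ : ζ ∈ DiamDirs K)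
    (hcong : ∀ w ∈ S2 ζ, DirCong w (projHyp w '' K) (projHyp w '' L)) :
    maxWidth L = maxWidth K ∧ ∀ w ∈ S2 ζ, ∀ (φ : E4 ≃ₗᵢ[ℝ] E4) (a : E4), φ w = w →
      φ '' (projHyp w '' K) = (fun x => x + a) '' (projHyp w '' L) → φ ζ ∈ DiamDirs L := by
  have hle : maxWidth L ≤ maxWidth K := by
    refine csSup_le ⟨_, ζ, hζ.1, rfl⟩ ?_
    rintro _ ⟨x, hx, rfl⟩
    obtain ⟨w, hw, hxw⟩ := exists_mem_S2_inner_eq_zero ζ x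
    obtain ⟨φ, hφ, a, -, h⟩ := hcong w hw
    rw [← widthFn_symm_eq hK hL hKne hLne hφ.1 h hxw]
    exact widthFn_le_maxWidth hK (map_mem_sph _ hx)
  have hmap : ∀ w ∈ S2 ζ, ∀ (φ : E4 ≃ₗᵢ[ℝ] E4) (a : E4), φ w = w →
      φ '' (projHyp w '' K) = (fun x => x + a) '' (projHyp w '' L) →
      widthFn L (φ ζ) = maxWidth K := by
    intro w hw φ a hφ h
    have hζw : ⟪φ ζ, w⟫ = 0 := by
      have := φ.inner_map_map ζ w
      rw [hφ] at this
      rw [this, real_inner_comm, hw.2]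
    rw [← widthFn_symm_eq hK hL hKne hLne hφ h hζw, φ.symm_apply_apply, hζ.2]
  have heq : maxWidth L = maxWidth K := by
    refine le_antisymm hle ?_
    obtain ⟨w, hw, -⟩ := exists_mem_S2_inner_eq_zero ζ ζ
    obtain ⟨φ, hφ, a, -, h⟩ := hcong w hw
    rw [← hmap w hw φ a hφ.1 h]
    exact widthFn_le_maxWidth hL (map_mem_sph _ hζ.1)
  exact ⟨heq, fun w hw φ a hφ h => ⟨map_mem_sph _ hζ.1, by rw [heq, hmap w hw φ a hφ h]⟩⟩

end Diameters

/-- The map `ι` identifies `ℝ³` isometrically with `ζ^⊥`. -/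
structure IsPerpChart (ζ : E4) (ι : (Fin 3 → ℝ) →ₗ[ℝ] E4) : Prop where
  inner_map : ∀ x y, ⟪ι x, ι y⟫ = x ⬝ᵥ y
  inner_self : ⟪ζ, ζ⟫ = 1
  inner_perp : ∀ x, ⟪ι x, ζ⟫ = 0
  exists_eq : ∀ v, ⟪v, ζ⟫ = 0 → ∃ x, ι x = v

lemma exists_isPerpChart {ζ : E4} (hζ : ζ ∈ sph) : ∃ ι, IsPerpChart ζ ι := by
  have hζ1 := inner_self_of_mem_sph hζ
  have hζ0 : ζ ≠ 0 := by
    rintro rfl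
    simp at hζ1
  have : Fact (Module.finrank ℝ E4 = 3 + 1) := ⟨by simp⟩
  set B := OrthonormalBasis.fromOrthogonalSpanSingleton (𝕜 := ℝ) 3 hζ0
  refine ⟨(ℝ ∙ ζ)ᗮ.subtype ∘ₗ B.repr.symm.toLinearEquiv.toLinearMap ∘ₗ
    (WithLp.linearEquiv 2 ℝ (Fin 3 → ℝ)).symm.toLinearMap, ?_, hζ1, ?_, ?_⟩
  · intro x y
    simp only [LinearMap.comp_apply, Submodule.subtype_apply, ← Submodule.coe_inner]
    change ⟪B.repr.symm (WithLp.toLp 2 x), B.repr.symm (WithLp.toLp 2 y)⟫ = _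
    rw [B.repr.symm.inner_map_map, EuclideanSpace.inner_toLp_toLp, dotProduct_comm]
    simp
  · intro x
    rw [real_inner_comm]
    exact Submodule.mem_orthogonal_singleton_iff_inner_right.1 (Submodule.coe_mem _)
  · intro v hv
    have hv' : v ∈ (ℝ ∙ ζ)ᗮ := Submodule.mem_orthogonal_singleton_iff_inner_left.2 hv
    refine ⟨(B.repr ⟨v, hv'⟩).ofLp, ?_⟩
    simp

namespace IsPerpChart

variable {ζ : E4} {ι : (Fin 3 → ℝ) →ₗ[ℝ] E4}

lemma continuous (_h : IsPerpChart ζ ι) : Continuous ι := ι.continuous_of_finiteDimensional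

lemma mem_sph (h : IsPerpChart ζ ι) {x : Fin 3 → ℝ} (hx : x ⬝ᵥ x = 1) : ι x ∈ sph := by
  rw [sph, mem_sphere_zero_iff_norm, ← sq_eq_sq₀ (norm_nonneg _) zero_le_one,
    ← real_inner_self_eq_norm_sq, h.inner_map, hx, one_pow]

lemma mem_S2 (h : IsPerpChart ζ ι) {x : Fin 3 → ℝ} (hx : x ⬝ᵥ x = 1) : ι x ∈ S2 ζ :=
  ⟨h.mem_sph hx, h.inner_perp x⟩

lemma exists_decomp (h : IsPerpChart ζ ι) (v : E4) : ∃ x, v = ι x + ⟪v, ζ⟫ • ζ := by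
  obtain ⟨x, hx⟩ := h.exists_eq (v - ⟪v, ζ⟫ • ζ)
    (by rw [inner_sub_left, real_inner_smul_left, h.inner_self, mul_one, sub_self])
  exact ⟨x, by rw [hx, sub_add_cancel]⟩

lemma inner_decomp (h : IsPerpChart ζ ι) (x y : Fin 3 → ℝ) (s : ℝ) :
    ⟪ι x + s • ζ, ι y⟫ = x ⬝ᵥ y := by
  rw [inner_add_left, h.inner_map, real_inner_smul_left, real_inner_comm, h.inner_perp, mul_zero,
    add_zero]

/-- The action of an isometry fixing `ι w` and preserving the axis `ℝ ζ` on the plane orthogonal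
to both. -/
lemma exists_cpt_of_fixed (h : IsPerpChart ζ ι) {a b w : Fin 3 → ℝ} (hab : IsFrame a b)
    (hw : w ⬝ᵥ w = 1) (haw : a ⬝ᵥ w = 0) (hbw : b ⬝ᵥ w = 0) {φ : E4 ≃ₗᵢ[ℝ] E4}
    (hφ : φ (ι w) = ι w) {ε : ℝ} (hε : ε = 1 ∨ ε = -1) (hφζ : φ ζ = ε • ζ)
    (hdet : LinearMap.det (φ.toLinearEquiv : E4 →ₗ[ℝ] E4) = 1) :
    ∃ α, ∀ θ, φ (ι (cpt a b θ)) = ι (cpt a b (α + ε * θ)) := by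
  have hεε : ε * ε = 1 := by rcases hε with rfl | rfl <;> norm_num
  have himg : ∀ x, x ⬝ᵥ w = 0 → ∃ y, ι y = φ (ι x) ∧ y ⬝ᵥ w = 0 := by
    intro x hx
    obtain ⟨y, hy⟩ := h.exists_eq (φ (ι x)) (by
      have h1 := φ.inner_map_map (ι x) ζ
      rw [hφζ, real_inner_smul_right, h.inner_perp] at h1
      rcases hε with rfl | rfl <;> simpa using h1)
    refine ⟨y, hy, ?_⟩
    rw [← h.inner_map, hy, ← hφ, φ.inner_map_map, h.inner_map, hx]
  obtain ⟨y, hy, hyw⟩ := himg a haw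
  obtain ⟨z, hz, hzw⟩ := himg b hbw
  have hyy : y ⬝ᵥ y = 1 := by rw [← h.inner_map, hy, φ.inner_map_map, h.inner_map, hab.1]
  have hzz : z ⬝ᵥ z = 1 := by rw [← h.inner_map, hz, φ.inner_map_map, h.inner_map, hab.2.1]
  have hzy : z ⬝ᵥ y = 0 := by
    rw [← h.inner_map, hz, hy, φ.inner_map_map, h.inner_map, dotProduct_comm, hab.2.2]
  obtain ⟨α, rfl⟩ := hab.exists_cpt_eq hw haw hbw hyy hyw
  have hfr := hab.cpt_frame α
  obtain ⟨γ, rfl⟩ := hfr.exists_cpt_eq hw (by simp [cpt, haw, hbw]) (by simp [cpt, haw, hbw])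
    hzz hzw
  have hcos : Real.cos γ = 0 := by
    have h1 : cpt a b (α + Real.pi / 2) ⬝ᵥ cpt a b α = 0 := by rw [dotProduct_comm, hfr.2.2]
    rw [cpt, add_dotProduct, smul_dotProduct, smul_dotProduct, hfr.1, h1] at hzy
    simpa using hzy
  have hb : φ (ι b) = ι (Real.sin γ • cpt a b (α + Real.pi / 2)) := by
    rw [← hz, cpt, hcos, zero_smul, zero_add]
  have hsin : Real.sin γ = ε := by
    set v : Fin 4 → E4 := ![ζ, ι w, ι a, ι b] with hv
    have hort : Orthonormal ℝ v := by
      rw [orthonormal_iff_ite]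
      intro i j
      have h1 : ∀ x, ⟪ζ, ι x⟫ = 0 := fun x => by rw [real_inner_comm, h.inner_perp]
      have h2 : ‖ζ‖ = 1 := by
        rw [← sq_eq_sq₀ (norm_nonneg _) zero_le_one, ← real_inner_self_eq_norm_sq, h.inner_self,
          one_pow]
      have h3 : ∀ x, x ⬝ᵥ x = 1 → ‖ι x‖ = 1 := fun x hx =>
        mem_sphere_zero_iff_norm.1 (h.mem_sph hx)
      fin_cases i <;> fin_cases j <;>
        simp [hv, h.inner_map, h.inner_perp, h1, h2, h3 w hw, h3 a hab.1, h3 b hab.2.1, haw, hbw,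
          hab.2.2, dotProduct_comm w, dotProduct_comm b a]
    set B := basisOfOrthonormalOfCardEqFinrank hort (by simp) with hB
    have hBv : ⇑B = v := coe_basisOfOrthonormalOfCardEqFinrank hort (by simp)
    set M : Matrix (Fin 4) (Fin 4) ℝ := !![ε, 0, 0, 0; 0, 1, 0, 0;
      0, 0, Real.cos α, -Real.sin γ * Real.sin α; 0, 0, Real.sin α, Real.sin γ * Real.cos α] with hM
    have hlin : (φ.toLinearEquiv : E4 →ₗ[ℝ] E4) = Matrix.toLin B B M := by
      refine B.ext fun i => ?_
      rw [Matrix.toLin_self, hBv, Fin.sum_univ_four]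
      fin_cases i
      · simpa [hv, hM] using hφζ
      · simpa [hv, hM] using hφ
      · simp [hv, hM, ← hy, cpt]
      · simp [hv, hM, hb, cpt, Real.cos_add, Real.sin_add, smul_add, smul_smul]
    rw [hlin, LinearMap.det_toLin] at hdet
    have hdet' : M.det = ε * Real.sin γ := by
      have := Real.sin_sq_add_cos_sq α
      simp [hM, Matrix.det_succ_row_zero, Fin.sum_univ_succ, Fin.succAbove]
      left
      linear_combination Real.sin γ * this
    rw [hdet'] at hdet
    linear_combination ε * hdet - Real.sin γ * hεε
  refine ⟨α, fun θ => ?_⟩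
  have h1 : φ (ι (cpt a b θ)) = Real.cos θ • φ (ι a) + Real.sin θ • φ (ι b) := by
    simp [cpt]
  rw [h1, hb, ← hy, hsin, ← map_smul, ← map_smul, ← map_add]
  congr 1
  ext i
  rcases hε with rfl | rfl
  · simp [cpt, Real.cos_add, Real.sin_add]
    ring
  · simp [cpt, Real.cos_add, Real.sin_add]
    ring

lemma exists_rotAbout (h : IsPerpChart ζ ι) {w : Fin 3 → ℝ}
    (hw : w ⬝ᵥ w = 1) {φ : E4 ≃ₗᵢ[ℝ] E4} (hφ : φ (ι w) = ι w) (hφζ : φ ζ = ζ)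
    (hdet : LinearMap.det (φ.toLinearEquiv : E4 →ₗ[ℝ] E4) = 1) :
    ∃ r ∈ Set.Icc 0 (2 * Real.pi), ∀ x, x ⬝ᵥ x = 1 → x ⬝ᵥ w = 0 →
      φ (ι x) = ι (rotAbout w r x) := by
  obtain ⟨a, b, ha, hb, hab, haw, hbw⟩ := exists_orthonormal_frame hw
  have hfr : IsFrame a b := ⟨ha, hb, hab⟩
  obtain ⟨α, hα⟩ := h.exists_cpt_of_fixed hfr hw haw hbw hφ (Or.inl rfl) (by rw [one_smul, hφζ])
    hdet
  obtain ⟨σ, hσ, hrot⟩ := hfr.exists_rotAbout_cpt hw haw hbw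
  obtain ⟨r, hr, hc, hs⟩ := exists_cos_sin_eq (Real.cos_sq_add_sin_sq (σ * α))
  refine ⟨r, hr, fun x hx hxw => ?_⟩
  obtain ⟨θ, rfl⟩ := hfr.exists_cpt_eq hw haw hbw hx hxw
  rw [rotAbout, ← hc, ← hs, ← rotAbout, hrot, hα, one_mul, add_comm]

lemma exists_reflLine (h : IsPerpChart ζ ι) {w : Fin 3 → ℝ}
    (hw : w ⬝ᵥ w = 1) {φ : E4 ≃ₗᵢ[ℝ] E4} (hφ : φ (ι w) = ι w) (hφζ : φ ζ = -ζ)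
    (hdet : LinearMap.det (φ.toLinearEquiv : E4 →ₗ[ℝ] E4) = 1) :
    ∃ u : UnitSph, u.1 ⬝ᵥ w = 0 ∧ ∀ x, x ⬝ᵥ x = 1 → x ⬝ᵥ w = 0 →
      φ (ι x) = ι (reflLine u.1 x) := by
  obtain ⟨a, b, ha, hb, hab, haw, hbw⟩ := exists_orthonormal_frame hw
  have hfr : IsFrame a b := ⟨ha, hb, hab⟩
  obtain ⟨α, hα⟩ := h.exists_cpt_of_fixed hfr hw haw hbw hφ (Or.inr rfl)
    (by rw [neg_one_smul, hφζ]) hdet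
  refine ⟨⟨cpt a b (α / 2), hfr.cpt_unit _⟩, by simp [cpt, haw, hbw], fun x hx hxw => ?_⟩
  obtain ⟨θ, rfl⟩ := hfr.exists_cpt_eq hw haw hbw hx hxw
  rw [hα, hfr.reflLine_cpt]
  congr 2
  ring

end IsPerpChart

lemma reflection_span_singleton {ζ : E4} (hζ : ζ ∈ sph) (v : E4) :
    (ℝ ∙ ζ).reflection v = Ocal ζ v := by
  rw [Submodule.reflection_singleton_apply, mem_sphere_zero_iff_norm.1 hζ, Ocal,
    real_inner_comm]
  simp [two_smul, two_mul, add_smul]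

lemma det_reflection_span_singleton {ζ : E4} (hζ : ζ ∈ sph) :
    LinearMap.det ((ℝ ∙ ζ).reflection.toLinearEquiv : E4 →ₗ[ℝ] E4) = -1 := by
  have hζ0 : ζ ≠ 0 := by
    rintro rfl
    simpa using inner_self_of_mem_sph hζ
  have : Fact (Module.finrank ℝ E4 = 3 + 1) := ⟨by simp⟩
  have h := (ℝ ∙ ζ).det_reflection
  rw [Submodule.finrank_orthogonal_span_singleton (n := 3) hζ0] at h
  exact h.trans (by norm_num)

lemma inner_Ocal (ζ x y : E4) : ⟪Ocal ζ x, y⟫ = ⟪x, Ocal ζ y⟫ := by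
  simp only [Ocal, inner_sub_left, inner_sub_right, real_inner_smul_left, real_inner_smul_right,
    real_inner_comm ζ]
  ring

lemma exists_halfTurn {p q : E4} (hp : p ∈ sph) (hq : q ∈ sph) (hpq : ⟪p, q⟫ = 0) :
    ∃ φ : E4 ≃ₗᵢ[ℝ] E4, IsRotAngleAbout p q 1 φ ∧
      ∀ v, ⟪v, p⟫ = 0 → φ.symm v = Ocal q v := by
  have hqp : ⟪q, p⟫ = 0 := by rw [real_inner_comm, hpq]
  have hpp := inner_self_of_mem_sph hp
  have hqq := inner_self_of_mem_sph hq
  set φ : E4 ≃ₗᵢ[ℝ] E4 :=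
    ((ℝ ∙ q).reflection.trans (ℝ ∙ p).reflection).trans (LinearIsometryEquiv.neg ℝ) with hφdef
  have hφ : ∀ v, φ v = -Ocal p (Ocal q v) := fun v => by
    rw [← reflection_span_singleton hp, ← reflection_span_singleton hq]
    rfl
  have hφ' : ∀ v, φ v = (2 * ⟪v, p⟫) • p + (2 * ⟪v, q⟫) • q - v := fun v => by
    rw [hφ, Ocal, Ocal, inner_sub_left, real_inner_smul_left, hqp]
    module
  have hfix : φ p = p := by
    rw [hφ', hpp, hpq]
    module
  have hdet : LinearMap.det (φ.toLinearEquiv : E4 →ₗ[ℝ] E4) = 1 := by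
    have h1 : (φ.toLinearEquiv : E4 →ₗ[ℝ] E4) = (-1 : ℝ) •
        (((ℝ ∙ p).reflection.toLinearEquiv : E4 →ₗ[ℝ] E4) ∘ₗ
          ((ℝ ∙ q).reflection.toLinearEquiv : E4 →ₗ[ℝ] E4)) := by
      ext1 v
      rw [neg_one_smul]
      rfl
    rw [h1, LinearMap.det_smul, LinearMap.det_comp, det_reflection_span_singleton hp,
      det_reflection_span_singleton hq, finrank_euclideanSpace_fin]
    norm_num
  refine ⟨φ, ⟨⟨hfix, hdet⟩, ?_, fun v hvp hvq => ?_⟩, fun v hv => ?_⟩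
  · rw [hφ', hqq, hqp]
    module
  · rw [hφ', hvp, hvq, one_mul, Real.cos_pi]
    simp
  · rw [LinearIsometryEquiv.symm_apply_eq, hφ', Ocal, inner_sub_left, inner_sub_left,
      real_inner_smul_left, real_inner_smul_left, hqp, hqq, hv]
    module

section Symmetry

variable {K L : Set E4}

lemma hasPiSymSet_of_centeredSupp (hK : IsCompact K) (hKc : Convex ℝ K) (hKne : K.Nonempty)
    {p q c : E4} (hp : p ∈ sph) (hq : q ∈ sph) (hpq : ⟪p, q⟫ = 0)
    (h : ∀ v, ⟪v, p⟫ = 0 → centeredSupp K c (Ocal q v) = centeredSupp K c v) :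
    HasPiSymSet p q (projHyp p '' K) := by
  obtain ⟨φ, hφ, hφs⟩ := exists_halfTurn hp hq hpq
  refine ⟨φ, hφ, image_eq_of_suppFn hK hKc hKne hp hφ.1.1 (c := φ c - c) fun v hv => ?_⟩
  have h1 := h v hv
  rw [← hφs v hv, centeredSupp, centeredSupp, inner_symm_apply] at h1
  rw [inner_sub_right]
  linarith

lemma IsCenter.centeredSupp_smul {d c : E4} (h : IsCenter K d c) (s : ℝ) :
    centeredSupp K c (s • d) = |s| * (widthFn K d / 2) := by
  rcases le_total 0 s with hs | hs
  · rw [_root_.centeredSupp_smul K c hs, h.centeredSupp_eq, abs_of_nonneg hs]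
  · rw [← neg_smul_neg, _root_.centeredSupp_smul K c (neg_nonneg.2 hs), h.neg.centeredSupp_eq,
      abs_of_nonpos hs, widthFn_neg]

end Symmetry

/-- Two positively homogeneous functions agreeing on unit vectors of the first factor agree. -/
lemma eq_of_homogeneous {f g : (Fin 3 → ℝ) → ℝ → ℝ}
    (hf : ∀ t, 0 ≤ t → ∀ x s, f (t • x) (t * s) = t * f x s)
    (hg : ∀ t, 0 ≤ t → ∀ x s, g (t • x) (t * s) = t * g x s) {x : Fin 3 → ℝ} (hx : x ≠ 0)
    (h : ∀ t : ℝ, (t • x) ⬝ᵥ (t • x) = 1 → f (t • x) = g (t • x)) (s : ℝ) : f x s = g x s := by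
  have hpos := dotProduct_self_pos hx
  set t := (Real.sqrt (x ⬝ᵥ x))⁻¹
  have ht : 0 < t := inv_pos.2 (Real.sqrt_pos.2 hpos)
  have h1 : (t • x) ⬝ᵥ (t • x) = 1 := by
    rw [smul_dotProduct, dotProduct_smul, smul_eq_mul, smul_eq_mul, ← mul_assoc, ← mul_inv,
      Real.mul_self_sqrt hpos.le, inv_mul_cancel₀ hpos.ne']
  have h2 := congrFun (h t h1) (t * s)
  rw [hf t ht.le, hg t ht.le] at h2
  exact mul_left_cancel₀ ht.ne' h2

lemma dense_dot_ne_zero {y : Fin 3 → ℝ} (hy : y ≠ 0) :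
    Dense {w : UnitSph | y ⬝ᵥ w.1 ≠ 0} := by
  intro w
  by_cases hw : y ⬝ᵥ w.1 = 0
  swap
  · exact subset_closure hw
  have hpos := dotProduct_self_pos hy
  set t := (Real.sqrt (y ⬝ᵥ y))⁻¹ with htdef
  have ht : 0 < t := inv_pos.2 (Real.sqrt_pos.2 hpos)
  have hfr : IsFrame w.1 (t • y) := by
    refine ⟨w.2, ?_, ?_⟩
    · rw [smul_dotProduct, dotProduct_smul, smul_eq_mul, smul_eq_mul, ← mul_assoc, ← mul_inv,
        Real.mul_self_sqrt hpos.le, inv_mul_cancel₀ hpos.ne']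
    · rw [dotProduct_smul, dotProduct_comm, hw, smul_zero]
  set γ : ℝ → UnitSph := fun θ => ⟨cpt w.1 (t • y) θ, hfr.cpt_unit θ⟩ with hγ
  have hγc : Continuous γ := by
    refine Continuous.subtype_mk (continuous_cpt continuous_const continuous_const continuous_id) _
  have hγ0 : γ 0 = w := Subtype.ext (by simp [hγ, cpt])
  have hlim : Tendsto γ (𝓝[>] 0) (𝓝 w) := by
    have := hγc.tendsto 0
    rw [hγ0] at this
    exact this.mono_left nhdsWithin_le_nhds
  refine mem_closure_of_tendsto hlim ?_
  filter_upwards [Ioo_mem_nhdsGT Real.pi_pos] with θ hθ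
  have hs := Real.sin_pos_of_pos_of_lt_pi hθ.1 hθ.2
  have : y ⬝ᵥ (γ θ).1 = Real.sin θ * (t * (y ⬝ᵥ y)) := by
    simp [hγ, cpt, dotProduct_add, dotProduct_smul, hw]
  rw [this]
  positivity

namespace IsPerpChart

variable {ζ : E4} {ι : (Fin 3 → ℝ) →ₗ[ℝ] E4}

lemma dense_inner_ne_zero (h : IsPerpChart ζ ι) {S : Set E4} (hS : S.Countable) (hS' : S ⊆ sph) :
    Dense {w : UnitSph | ∀ d ∈ S, d ≠ ζ → d ≠ -ζ → ⟪d, ι w.1⟫ ≠ 0} := by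
  have hset : {w : UnitSph | ∀ d ∈ S, d ≠ ζ → d ≠ -ζ → ⟪d, ι w.1⟫ ≠ 0} =
      ⋂ d ∈ {d ∈ S | d ≠ ζ ∧ d ≠ -ζ}, {w : UnitSph | ⟪d, ι w.1⟫ ≠ 0} := by
    ext w
    simp only [Set.mem_ofPred_eq, Set.mem_iInter]
    exact ⟨fun h d hd => h d hd.1 hd.2.1 hd.2.2, fun h d hd h1 h2 => h d ⟨hd, h1, h2⟩⟩
  rw [hset]
  refine dense_biInter_of_isOpen (fun d _ => ?_) (hS.mono (Set.sep_subset _ _)) ?_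
  · have := h.continuous
    exact isOpen_ne_fun (by fun_prop) continuous_const
  · rintro d ⟨hd, hd1, hd2⟩
    obtain ⟨y, hy⟩ := h.exists_decomp d
    have hy0 : y ≠ 0 := by
      rintro rfl
      rw [map_zero, zero_add] at hy
      have h1 := inner_self_of_mem_sph (hS' hd)
      rw [hy, real_inner_smul_left, real_inner_smul_right, h.inner_self, mul_one,
        mul_self_eq_one_iff] at h1
      rcases h1 with h1 | h1
      · exact hd1 (by rw [hy, h1, one_smul])
      · exact hd2 (by rw [hy, h1, neg_one_smul])
    have : {w : UnitSph | ⟪d, ι w.1⟫ ≠ 0} = {w : UnitSph | y ⬝ᵥ w.1 ≠ 0} := by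
      ext w
      rw [Set.mem_ofPred_eq, Set.mem_ofPred_eq, hy, h.inner_decomp]
    rw [this]
    exact dense_dot_ne_zero hy0

lemma Ocal_self_decomp (h : IsPerpChart ζ ι) (x : Fin 3 → ℝ) (s : ℝ) :
    Ocal ζ (ι x + s • ζ) = ι (-x) + s • ζ := by
  rw [Ocal, inner_add_left, h.inner_perp, real_inner_smul_left, h.inner_self, map_neg]
  module

lemma Ocal_decomp (h : IsPerpChart ζ ι) (u x : Fin 3 → ℝ) (s : ℝ) :
    Ocal (ι u) (ι x + s • ζ) = ι (reflLine u x) + (-s) • ζ := by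
  rw [Ocal, h.inner_decomp, reflLine, map_sub, map_smul]
  module

lemma dot_eq_zero (h : IsPerpChart ζ ι) {w x : Fin 3 → ℝ} {s : ℝ}
    (hv : ⟪ι x + s • ζ, ι w⟫ = 0) : x ⬝ᵥ w = 0 := by
  rwa [h.inner_decomp] at hv

end IsPerpChart

/-- The centered support function in the cylindrical coordinates given by `ζ` and `ι`. -/
def chartSupp (ζ : E4) (ι : (Fin 3 → ℝ) →ₗ[ℝ] E4) (K : Set E4) (c : E4) (x : Fin 3 → ℝ)
    (s : ℝ) : ℝ :=
  centeredSupp K c (ι x + s • ζ)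

section ChartSupp

variable {K L : Set E4} {ζ c : E4} {ι : (Fin 3 → ℝ) →ₗ[ℝ] E4}

lemma chartSupp_smul {t : ℝ} (ht : 0 ≤ t) (x : Fin 3 → ℝ) (s : ℝ) :
    chartSupp ζ ι K c (t • x) (t * s) = t * chartSupp ζ ι K c x s := by
  rw [chartSupp, chartSupp, ← centeredSupp_smul K c ht, map_smul, smul_add, smul_smul]

lemma continuous_chartSupp (hK : IsCompact K) (c : E4) :
    Continuous (chartSupp ζ ι K c) := by
  have h1 := ι.continuous_of_finiteDimensional
  have h2 := continuous_centeredSupp hK c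
  refine continuous_pi fun s => ?_
  unfold chartSupp
  fun_prop

lemma exists_chartSupp_ne_neg (h : IsPerpChart ζ ι) (hζ : ζ ∈ sph) (hK : IsCompact K)
    (hKc : Convex ℝ K) (hKne : K.Nonempty) {w : Fin 3 → ℝ} (hw : w ⬝ᵥ w = 1)
    (hsym : ¬ HasPiSymSet (ι w) ζ (projHyp (ι w) '' K)) :
    ∃ x, x ⬝ᵥ x = 1 ∧ x ⬝ᵥ w = 0 ∧ chartSupp ζ ι K c x ≠ chartSupp ζ ι K c (-x) := by
  contrapose! hsym
  refine hasPiSymSet_of_centeredSupp hK hKc hKne (c := c) (h.mem_sph hw) hζ (h.inner_perp w)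
    fun v hv => ?_
  obtain ⟨x, hx⟩ := h.exists_decomp v
  rw [hx] at hv ⊢
  have hxw := h.dot_eq_zero hv
  rw [h.Ocal_self_decomp]
  rcases eq_or_ne x 0 with rfl | hx0
  · rw [neg_zero]
  refine (eq_of_homogeneous (f := chartSupp ζ ι K c) (g := fun x => chartSupp ζ ι K c (-x))
    (fun t ht x s => chartSupp_smul ht x s)
    (fun t ht x s => by rw [← smul_neg, chartSupp_smul ht]) hx0
    (fun t ht => hsym _ ht (by rw [smul_dotProduct, hxw, smul_zero])) _).symm

lemma exists_chartSupp_ne_reflLine (h : IsPerpChart ζ ι) (hK : IsCompact K)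
    (hKc : Convex ℝ K) (hKne : K.Nonempty) (hc : IsCenter K ζ c) {w u : Fin 3 → ℝ}
    (hw : w ⬝ᵥ w = 1) (hu : u ⬝ᵥ u = 1) (huw : u ⬝ᵥ w = 0)
    (hsym : ¬ HasPiSymSet (ι w) (ι u) (projHyp (ι w) '' K)) :
    ∃ x, x ⬝ᵥ x = 1 ∧ x ⬝ᵥ w = 0 ∧
      chartSupp ζ ι K c x ≠ fun s => chartSupp ζ ι K c (reflLine u x) (-s) := by
  contrapose! hsym
  refine hasPiSymSet_of_centeredSupp hK hKc hKne (c := c) (h.mem_sph hw) (h.mem_sph hu)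
    (by rw [h.inner_map, dotProduct_comm, huw]) fun v hv => ?_
  obtain ⟨x, hx⟩ := h.exists_decomp v
  rw [hx] at hv ⊢
  have hxw := h.dot_eq_zero hv
  rw [h.Ocal_decomp]
  rcases eq_or_ne x 0 with rfl | hx0
  · rw [reflLine, zero_dotProduct, mul_zero, zero_smul, sub_zero, map_zero, zero_add, zero_add,
      hc.centeredSupp_smul, hc.centeredSupp_smul, abs_neg]
  refine (eq_of_homogeneous (f := chartSupp ζ ι K c)
    (g := fun x s => chartSupp ζ ι K c (reflLine u x) (-s))
    (fun t ht x s => chartSupp_smul ht x s)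
    (fun t ht x s => ?_) hx0
    (fun t ht => hsym _ ht (by rw [smul_dotProduct, hxw, smul_zero])) _).symm
  have : reflLine u (t • x) = t • reflLine u x := by
    rw [reflLine, reflLine, smul_dotProduct, smul_eq_mul]
    module
  rw [this, ← mul_neg, chartSupp_smul ht]

end ChartSupp

section Main

variable {K L : Set E4} {ζ : E4}

lemma chartSupp_rotAbout_or_reflLine (hK : IsCompact K) (hL : IsCompact L) (hKne : K.Nonempty)
    (hLne : L.Nonempty) {ι : (Fin 3 → ℝ) →ₗ[ℝ] E4} (hι : IsPerpChart ζ ι) {c c' a : E4}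
    (hc : IsCenter K ζ c) (hc' : IsCenter L ζ c') {w : UnitSph} {φ : E4 ≃ₗᵢ[ℝ] E4}
    (hφ : IsRot (ι w.1) φ) (hφζ : φ ζ = ζ ∨ φ ζ = -ζ)
    (h : φ '' (projHyp (ι w.1) '' K) = (fun x => x + a) '' (projHyp (ι w.1) '' L)) :
    (∃ r ∈ Set.Icc 0 (2 * Real.pi), ∀ x, x ⬝ᵥ x = 1 → x ⬝ᵥ w.1 = 0 →
      chartSupp ζ ι L c' x = chartSupp ζ ι K c (rotAbout w.1 r x)) ∨
    (∃ u : UnitSph, u.1 ⬝ᵥ w.1 = 0 ∧ ∀ x, x ⬝ᵥ x = 1 → x ⬝ᵥ w.1 = 0 →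
      chartSupp ζ ι L c' x = fun s => chartSupp ζ ι K c (reflLine u.1 x) (-s)) := by
  have hφs : φ.symm (ι w.1) = ι w.1 := by rw [LinearIsometryEquiv.symm_apply_eq, hφ.1]
  have hdet : LinearMap.det (φ.symm.toLinearEquiv : E4 →ₗ[ℝ] E4) = 1 := by
    have h1 := LinearEquiv.det_coe_symm φ.toLinearEquiv
    rw [hφ.2, inv_one] at h1
    exact h1
  have hζw : ⟪ζ, ι w.1⟫ = 0 := by rw [real_inner_comm, hι.inner_perp]
  have hcL : IsCenter L (φ ζ) c' := by
    rcases hφζ with h1 | h1 <;> rw [h1]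
    exacts [hc', hc'.neg]
  have key : ∀ x, x ⬝ᵥ w.1 = 0 → ∀ s,
      chartSupp ζ ι L c' x s = centeredSupp K c (φ.symm (ι x) + s • φ.symm ζ) := by
    intro x hxw s
    rw [← map_smul, ← map_add, centeredSupp_symm_eq hK hL hKne hLne hφ.1 hζw h hc hcL
      (by rw [hι.inner_decomp, hxw]), chartSupp]
  rcases hφζ with h1 | h1
  · have h2 : φ.symm ζ = ζ := by rw [LinearIsometryEquiv.symm_apply_eq, h1]
    obtain ⟨r, hr, hrot⟩ := hι.exists_rotAbout w.2 hφs h2 hdet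
    refine Or.inl ⟨r, hr, fun x hx hxw => funext fun s => ?_⟩
    rw [key x hxw, hrot x hx hxw, h2, chartSupp]
  · have h2 : φ.symm ζ = -ζ := by rw [LinearIsometryEquiv.symm_apply_eq, map_neg, h1, neg_neg]
    obtain ⟨u, hu, hrefl⟩ := hι.exists_reflLine w.2 hφs h2 hdet
    refine Or.inr ⟨u, hu, fun x hx hxw => funext fun s => ?_⟩
    rw [key x hxw, hrefl x hx hxw, h2, chartSupp, smul_neg, neg_smul]

/-- After centering at the common diameter direction `ζ`, the support functions of `K` and `L`
agree up to `Ocal ζ`. -/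
lemma centeredSupp_eq_or_eq_Ocal (hK : IsConvexBody K) (hL : IsConvexBody L)
    (hLc : (DiamDirs L).Countable) (hζK : ζ ∈ DiamDirs K)
    (hcong : ∀ w ∈ S2 ζ, DirCong w (projHyp w '' K) (projHyp w '' L))
    (hsym : ∀ w ∈ S2 ζ, ¬ HasPiSymSet w ζ (projHyp w '' K) ∧
      ∀ u ∈ S2 ζ ∩ S2 w, ¬ HasPiSymSet w u (projHyp w '' K)) :
    ∃ c c', (∀ v, centeredSupp L c' v = centeredSupp K c v) ∨
      (∀ v, centeredSupp L c' v = centeredSupp K c (Ocal ζ v)) := by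
  have hKne : K.Nonempty := hK.2.2.mono interior_subset
  have hLne : L.Nonempty := hL.2.2.mono interior_subset
  have hζ := hζK.1
  obtain ⟨ι, hι⟩ := exists_isPerpChart hζ
  obtain ⟨hmax, hmap⟩ := map_mem_diamDirs hK.1 hL.1 hKne hLne hζK hcong
  set D := {w : UnitSph | ∀ d ∈ DiamDirs L, d ≠ ζ → d ≠ -ζ → ⟪d, ι w.1⟫ ≠ 0}
  have hD : Dense D := hι.dense_inner_ne_zero hLc fun d hd => hd.1
  have hpm : ∀ w ∈ D, ∀ (φ : E4 ≃ₗᵢ[ℝ] E4) (a : E4), φ (ι w.1) = ι w.1 →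
      φ '' (projHyp (ι w.1) '' K) = (fun x => x + a) '' (projHyp (ι w.1) '' L) →
      φ ζ = ζ ∨ φ ζ = -ζ := by
    intro w hw φ a hφ h
    by_contra! hne
    refine hw _ (hmap _ (hι.mem_S2 w.2) φ a hφ h) hne.1 hne.2 ?_
    have := φ.inner_map_map ζ (ι w.1)
    rw [hφ] at this
    rw [this, real_inner_comm, hι.inner_perp]
  have hζL : ζ ∈ DiamDirs L := by
    have : Nonempty UnitSph := ⟨⟨Pi.single 0 1, by simp⟩⟩
    obtain ⟨w, hw⟩ := hD.nonempty
    obtain ⟨φ, hφ, a, -, h⟩ := hcong _ (hι.mem_S2 w.2)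
    have h1 := hmap _ (hι.mem_S2 w.2) φ a hφ.1 h
    rcases hpm w hw φ a hφ.1 h with h2 | h2 <;> rw [h2] at h1
    · exact h1
    · exact ⟨hζ, by rw [← widthFn_neg, h1.2]⟩
  obtain ⟨c, hc⟩ := exists_isCenter hK.1 hKne hζK
  obtain ⟨c', hc'⟩ := exists_isCenter hL.1 hLne hζL
  have hwidth : widthFn L ζ = widthFn K ζ := by rw [hζL.2, hζK.2, hmax]
  have hzero : ∀ s, chartSupp ζ ι L c' 0 s = chartSupp ζ ι K c 0 s := fun s => by
    rw [chartSupp, chartSupp, map_zero, zero_add, hc.centeredSupp_smul, hc'.centeredSupp_smul,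
      hwidth]
  have hF := continuous_chartSupp (ζ := ζ) (ι := ι) hK.1 c
  have hF' : Continuous fun x s => chartSupp ζ ι K c x (-s) :=
    continuous_pi fun s => (continuous_apply (-s)).comp hF
  refine ⟨c, c', ?_⟩
  rcases eq_or_eq_neg_of_dense hF (continuous_chartSupp hL.1 c') hF' D hD
    (fun w hw => by
      obtain ⟨φ, hφ, a, -, h⟩ := hcong _ (hι.mem_S2 w.2)
      exact chartSupp_rotAbout_or_reflLine hK.1 hL.1 hKne hLne hι hc hc' hφ
        (hpm w hw φ a hφ.1 h) h)
    (fun w => exists_chartSupp_ne_neg hι hζ hK.1 hK.2.1 hKne w.2 (hsym _ (hι.mem_S2 w.2)).1)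
    (fun w u huw => exists_chartSupp_ne_reflLine hι hK.1 hK.2.1 hKne hc w.2 u.2 huw
      ((hsym _ (hι.mem_S2 w.2)).2 _ ⟨hι.mem_S2 u.2, hι.mem_sph u.2, by rw [hι.inner_map, huw]⟩))
    with h | h
  · refine Or.inl fun v => ?_
    obtain ⟨x, hx⟩ := hι.exists_decomp v
    rw [hx]
    rcases eq_or_ne x 0 with rfl | hx0
    · exact hzero _
    · exact eq_of_homogeneous (f := chartSupp ζ ι L c') (g := chartSupp ζ ι K c)
        (fun t ht x s => chartSupp_smul ht x s) (fun t ht x s => chartSupp_smul ht x s) hx0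
        (fun t ht => h _ ht) _
  · refine Or.inr fun v => ?_
    obtain ⟨x, hx⟩ := hι.exists_decomp v
    rw [hx, hι.Ocal_self_decomp]
    rcases eq_or_ne x 0 with rfl | hx0
    · rw [neg_zero]
      exact hzero _
    · exact eq_of_homogeneous (f := chartSupp ζ ι L c') (g := fun x => chartSupp ζ ι K c (-x))
        (fun t ht x s => chartSupp_smul ht x s)
        (fun t ht x s => by rw [← smul_neg, chartSupp_smul ht]) hx0
        (fun t ht => h _ ht) _

lemma eq_translate_of_centeredSupp (hK : IsConvexBody K) (hL : IsConvexBody L) {c c' : E4}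
    (h : ∀ v, centeredSupp L c' v = centeredSupp K c v) : K = (fun x => x + (c - c')) '' L := by
  have hKne : K.Nonempty := hK.2.2.mono interior_subset
  have hLne : L.Nonempty := hL.2.2.mono interior_subset
  refine eq_of_suppFn_eq hK.1 (hL.1.image (by fun_prop)) hK.2.1 ?_ hKne (hLne.image _) fun v => ?_
  · simpa only [add_comm] using hL.2.1.translate (c - c')
  · rw [suppFn_image hL.1 hLne (x' := v) (c := ⟪v, c - c'⟫) fun y _ => inner_add_right _ _ _]
    have := h v
    rw [centeredSupp, centeredSupp] at this
    rw [inner_sub_right]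
    linarith

lemma Ocal_Ocal (hζ : ζ ∈ sph) (v : E4) : Ocal ζ (Ocal ζ v) = v := by
  rw [← reflection_span_singleton hζ, ← reflection_span_singleton hζ,
    Submodule.reflection_reflection]

lemma eq_Ocal_translate_of_centeredSupp (hζ : ζ ∈ sph) (hK : IsConvexBody K)
    (hL : IsConvexBody L) {c c' : E4}
    (h : ∀ v, centeredSupp L c' v = centeredSupp K c (Ocal ζ v)) :
    K = (fun x => Ocal ζ x + (c - Ocal ζ c')) '' L := by
  have hKne : K.Nonempty := hK.2.2.mono interior_subset
  have hLne : L.Nonempty := hL.2.2.mono interior_subset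
  have himg : (fun x => Ocal ζ x + (c - Ocal ζ c')) =
      (fun x => x + (c - Ocal ζ c')) ∘ (ℝ ∙ ζ).reflection :=
    funext fun x => by rw [Function.comp_apply, reflection_span_singleton hζ]
  have hcont : Continuous fun x => Ocal ζ x + (c - Ocal ζ c') := by
    rw [himg]
    fun_prop
  refine eq_of_suppFn_eq hK.1 (hL.1.image hcont) hK.2.1 ?_ hKne (hLne.image _) fun v => ?_
  · rw [himg, Set.image_comp]
    have himg' : Convex ℝ ((ℝ ∙ ζ).reflection '' L) :=
      hL.2.1.linear_image (ℝ ∙ ζ).reflection.toLinearEquiv.toLinearMap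
    simpa only [add_comm] using himg'.translate (c - Ocal ζ c')
  · rw [suppFn_image hL.1 hLne (x' := Ocal ζ v) (c := ⟪v, c - Ocal ζ c'⟫) fun y _ => by
      rw [inner_add_right, inner_Ocal]]
    have := h (Ocal ζ v)
    rw [Ocal_Ocal hζ, centeredSupp, centeredSupp, inner_Ocal] at this
    rw [inner_sub_right]
    linarith

lemma hasRigidSym_of_dirCong (hζ : ζ ∈ sph) (hK : IsConvexBody K) (hL : IsConvexBody L) {b : E4}
    (hKL : K = (fun x => Ocal ζ x + b) '' L)
    (hcong : DirCong ζ (projHyp ζ '' K) (projHyp ζ '' L)) : HasRigidSym ζ (projHyp ζ '' K) := by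
  have hKne : K.Nonempty := hK.2.2.mono interior_subset
  have hLne : L.Nonempty := hL.2.2.mono interior_subset
  obtain ⟨φ, hφ, a, -, h⟩ := hcong
  have hζζ := inner_self_of_mem_sph hζ
  set ψ := φ.trans (ℝ ∙ ζ).reflection with hψdef
  have hψ : ∀ v, ψ v = Ocal ζ (φ v) := fun v => by
    rw [← reflection_span_singleton hζ]
    rfl
  have hψs : ∀ v, ψ.symm v = φ.symm (Ocal ζ v) := fun v => by
    rw [LinearIsometryEquiv.symm_apply_eq, hψ, φ.apply_symm_apply, Ocal_Ocal hζ]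
  have hψζ : ψ ζ = ζ := by
    rw [hψ, hφ.1, Ocal, hζζ]
    module
  have hLK : ∀ v, suppFn K (Ocal ζ v) = suppFn L v + ⟪Ocal ζ v, b⟫ := fun v => by
    rw [hKL]
    refine suppFn_image hL.1 hLne fun y _ => ?_
    rw [inner_add_right, ← inner_Ocal, Ocal_Ocal hζ]
  refine ⟨ψ, hψζ, ?_, image_eq_of_suppFn hK.1 hK.2.1 hKne hζ hψζ (c := -(a + b))
    fun x hx => ?_⟩
  · by_contra! hid
    have hψ1 : ∀ v, ψ v = v := fun v => by
      rw [projHyp_add_smul ζ v, map_add, map_smul, hψζ, hid _ (inner_projHyp_self hζ v)]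
    have hφR : φ = (ℝ ∙ ζ).reflection := by
      ext1 v
      rw [reflection_span_singleton hζ, ← Ocal_Ocal hζ (φ v), ← hψ, hψ1]
    have h1 := hφ.2
    rw [hφR, det_reflection_span_singleton hζ] at h1
    norm_num at h1
  · have hO : Ocal ζ x = -x := by
      rw [Ocal, hx]
      module
    have h1 := hLK (-x)
    rw [hψs, suppFn_of_image_eq hK.1 hL.1 hKne hLne hφ.1 h (by
      rw [hO, inner_neg_left, hx, neg_zero]), hO]
    have hO' : Ocal ζ (-x) = x := by rw [← hO, Ocal_Ocal hζ]
    rw [hO'] at h1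
    rw [inner_neg_left, inner_neg_right, inner_add_right]
    linarith

end Main

end DirectCongruence

/-- Theorem 1: bodies in `ℝ⁴` with directly congruent projections. -/
theorem stmt_10 (K L : Set E4) (hK : IsConvexBody K) (hL : IsConvexBody L)
    (hKc : (DiamDirs K).Countable) (hLc : (DiamDirs L).Countable)
    (ζ : E4) (hζ : ζ ∈ sph) (hζK : ζ ∈ DiamDirs K)
    (hcong : ∀ w ∈ S2 ζ, DirCong w (projHyp w '' K) (projHyp w '' L))
    (hsym : ∀ w ∈ S2 ζ,
      (¬ HasPiSymSet w ζ (projHyp w '' K) ∧ ¬ HasPiSymSet w ζ (projHyp w '' L)) ∧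
      ∀ u ∈ S2 ζ ∩ S2 w,
        ¬ HasPiSymSet w u (projHyp w '' K) ∧ ¬ HasPiSymSet w u (projHyp w '' L)) :
    (∃ b : E4, K = (fun x => x + b) '' L ∨ K = (fun x => Ocal ζ x + b) '' L) ∧
    ((DirCong ζ (projHyp ζ '' K) (projHyp ζ '' L) ∧
        ¬ HasRigidSym ζ (projHyp ζ '' K) ∧ ¬ HasRigidSym ζ (projHyp ζ '' L)) →
      ∃ b : E4, K = (fun x => x + b) '' L) := by
  obtain ⟨c, c', h | h⟩ := centeredSupp_eq_or_eq_Ocal hK hL hLc hζK hcong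
    fun w hw => ⟨(hsym w hw).1.1, fun u hu => ((hsym w hw).2 u hu).1⟩
  · have hKL := eq_translate_of_centeredSupp hK hL h
    exact ⟨⟨_, Or.inl hKL⟩, fun _ => ⟨_, hKL⟩⟩
  · have hKL := eq_Ocal_translate_of_centeredSupp hζ hK hL h
    exact ⟨⟨_, Or.inr hKL⟩, fun hrig =>
      absurd (hasRigidSym_of_dirCong hζ hK hL hKL hrig.1) hrig.2.1⟩
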